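/- arXiv:2007.07034 — 2 statements merged into one kernel-verified Lean document; each statement's English description precedes it below -/
import Mathlib

section
/- There exists an absolute constant C > 0 with the following property: let {D_j} be a (possibly infinite) collection of closed unit disks in ℝ² whose pairwise distances are at least 1000, let R' > 2000, and let h be a real-valued harmonic function on B(0, R') ∖ ⋃_j D_j. Assume that for every j the function h does not change sign on (5D_j ∖ D_j) ∩ B(0, R'). Then sup over B(0, R') ∖ ⋃_j 3D_j of |h| is at most exp(C·R') times the sup of |h| over {z : R'/8 < |z| < R'} ∖ ⋃_j 3D_j. -/
noncomputable section

open MeasureTheory Metric Filter Set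
open scoped Topology ENNReal RealInnerProductSpace

/-- The Euclidean plane. -/
abbrev E2 : Type := EuclideanSpace ℝ (Fin 2)

/-- The Laplacian of a function on `ℝⁿ`, computed via iterated Fréchet derivatives in the
coordinate directions. -/
def lap {n : ℕ} (f : EuclideanSpace ℝ (Fin n) → ℝ) (x : EuclideanSpace ℝ (Fin n)) : ℝ :=
  ∑ i : Fin n, fderiv ℝ (fun y => fderiv ℝ f y (EuclideanSpace.single i 1)) x
    (EuclideanSpace.single i 1)

/-- A test function on a set `Ω`: smooth, compactly supported, with support inside `Ω`. -/
def IsTestFun {n : ℕ} (Ω : Set (EuclideanSpace ℝ (Fin n)))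
    (h : EuclideanSpace ℝ (Fin n) → ℝ) : Prop :=
  ContDiff ℝ (⊤ : ℕ∞) h ∧ HasCompactSupport h ∧ tsupport h ⊆ Ω

/-- `u` is a weak solution of `Δu + Vu = 0` on `Ω`:
`∫_Ω u Δh + ∫_Ω V u h = 0` for every test function `h` on `Ω`. -/
def IsWeakSol {n : ℕ} (Ω : Set (EuclideanSpace ℝ (Fin n)))
    (V u : EuclideanSpace ℝ (Fin n) → ℝ) : Prop :=
  ∀ h, IsTestFun Ω h →
    (∫ x in Ω, u x * lap h x) + (∫ x in Ω, V x * u x * h x) = 0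

/-- The supremum of `|u|` over a set `s`. -/
def supAbs {n : ℕ} (u : EuclideanSpace ℝ (Fin n) → ℝ) (s : Set (EuclideanSpace ℝ (Fin n))) : ℝ :=
  sSup ((fun z => |u z|) '' s)

/-- A family of closed unit balls (given by their centers) is `L`-separated if any two distinct
balls of the family are at distance at least `L` from each other. -/
def UnitBallsSeparated {n : ℕ} {ι : Type} (c : ι → EuclideanSpace ℝ (Fin n)) (L : ℝ) : Prop :=
  ∀ i j, i ≠ j → ∀ x ∈ closedBall (c i) 1, ∀ y ∈ closedBall (c j) 1, L ≤ dist x y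

/-- `u` is harmonic at every point of `s` (for `s` open this is usual harmonicity on `s`). -/
def HarmonicOnSet {n : ℕ} (u : EuclideanSpace ℝ (Fin n) → ℝ)
    (s : Set (EuclideanSpace ℝ (Fin n))) : Prop :=
  ∀ x ∈ s, ContDiffAt ℝ 2 u x ∧ lap u x = 0

/-- `u` does not change sign on `s`. -/
def NoSignChange {n : ℕ} (u : EuclideanSpace ℝ (Fin n) → ℝ)
    (s : Set (EuclideanSpace ℝ (Fin n))) : Prop :=
  (∀ x ∈ s, 0 ≤ u x) ∨ (∀ x ∈ s, u x ≤ 0)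

/-- The derivative of `f` in the direction `v`. -/
def pd (v : ℂ) (f : ℂ → ℝ) (z : ℂ) : ℝ := fderiv ℝ f z v

/-- The Laplacian of a function on the complex plane. -/
def lapC (f : ℂ → ℝ) (z : ℂ) : ℝ := pd 1 (pd 1 f) z + pd Complex.I (pd Complex.I f) z

lemma contDiffAt_pd {f : ℂ → ℝ} {z : ℂ} (v : ℂ) {n : ℕ} (hf : ContDiffAt ℝ (n + 1 : ℕ) f z) :
    ContDiffAt ℝ n (pd v f) z :=
  (hf.fderiv_right (m := n) (by norm_cast)).clm_apply contDiffAt_const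

lemma contDiff_pd {f : ℂ → ℝ} (v : ℂ) {n : ℕ} (hf : ContDiff ℝ (n + 1 : ℕ) f) :
    ContDiff ℝ n (pd v f) :=
  contDiff_iff_contDiffAt.2 fun _ => contDiffAt_pd v hf.contDiffAt

lemma HasCompactSupport.pd {f : ℂ → ℝ} (v : ℂ) (hf : HasCompactSupport f) :
    HasCompactSupport (pd v f) :=
  hf.fderiv_apply (𝕜 := ℝ) v

lemma pd_eventuallyEq {f g : ℂ → ℝ} {z : ℂ} (v : ℂ) (h : f =ᶠ[𝓝 z] g) :
    pd v f =ᶠ[𝓝 z] pd v g := by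
  filter_upwards [h.fderiv (𝕜 := ℝ)] with w hw
  simp only [pd, hw]

lemma lapC_congr {f g : ℂ → ℝ} {z : ℂ} (h : f =ᶠ[𝓝 z] g) : lapC f z = lapC g z := by
  unfold lapC
  rw [(pd_eventuallyEq _ (pd_eventuallyEq _ h)).eq_of_nhds,
    (pd_eventuallyEq _ (pd_eventuallyEq _ h)).eq_of_nhds]

lemma pd_mul {f g : ℂ → ℝ} {z : ℂ} (v : ℂ) (hf : DifferentiableAt ℝ f z)
    (hg : DifferentiableAt ℝ g z) :
    pd v (fun w => f w * g w) z = f z * pd v g z + pd v f z * g z := by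
  simp only [pd, fderiv_fun_mul hf hg]
  simp [mul_comm]

lemma pd_add {f g : ℂ → ℝ} {z : ℂ} (v : ℂ) (hf : DifferentiableAt ℝ f z)
    (hg : DifferentiableAt ℝ g z) :
    pd v (fun w => f w + g w) z = pd v f z + pd v g z := by
  simp only [pd, fderiv_fun_add hf hg]
  simp

lemma pd_mul_eventuallyEq {f g : ℂ → ℝ} {z : ℂ} (v : ℂ) (hf : ContDiffAt ℝ 2 f z)
    (hg : ContDiffAt ℝ 2 g z) :
    pd v (fun w => f w * g w) =ᶠ[𝓝 z] fun w => f w * pd v g w + pd v f w * g w := by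
  filter_upwards [hf.eventually (by simp), hg.eventually (by simp)] with w hw1 hw2
  exact pd_mul v (hw1.differentiableAt (by simp)) (hw2.differentiableAt (by simp))

lemma pd_pd_mul {f g : ℂ → ℝ} {z : ℂ} (v : ℂ) (hf : ContDiffAt ℝ 2 f z)
    (hg : ContDiffAt ℝ 2 g z) :
    pd v (pd v (fun w => f w * g w)) z
      = f z * pd v (pd v g) z + 2 * (pd v f z * pd v g z) + pd v (pd v f) z * g z := by
  have hf' := (contDiffAt_pd (n := 1) v hf).differentiableAt (by simp)
  have hg' := (contDiffAt_pd (n := 1) v hg).differentiableAt (by simp)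
  have hf0 := hf.differentiableAt (by simp)
  have hg0 := hg.differentiableAt (by simp)
  rw [(pd_eventuallyEq v (pd_mul_eventuallyEq v hf hg)).eq_of_nhds,
    pd_add (f := fun w => f w * pd v g w) (g := fun w => pd v f w * g w) v (hf0.mul hg')
      (hf'.mul hg0), pd_mul v hf0 hg',
    pd_mul v hf' hg0]
  ring

lemma lapC_mul {f g : ℂ → ℝ} {z : ℂ} (hf : ContDiffAt ℝ 2 f z) (hg : ContDiffAt ℝ 2 g z) :
    lapC (fun w => f w * g w) z = f z * lapC g z
      + 2 * (pd 1 f z * pd 1 g z + pd Complex.I f z * pd Complex.I g z) + lapC f z * g z := by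
  simp only [lapC, pd_pd_mul _ hf hg]
  ring

lemma integral_mul_pd {f g : ℂ → ℝ} (v : ℂ) (hf : ContDiff ℝ 1 f) (hg : ContDiff ℝ 1 g)
    (hfs : HasCompactSupport f) :
    ∫ z, f z * pd v g z = -∫ z, pd v f z * g z := by
  have hf' : Continuous (pd v f) := (contDiff_pd (n := 0) v hf).continuous
  have hg' : Continuous (pd v g) := (contDiff_pd (n := 0) v hg).continuous
  refine integral_mul_fderiv_eq_neg_fderiv_mul_of_integrable ?_ ?_ ?_
    (fun x _ => hf.contDiffAt.differentiableAt (by simp))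
    (fun x _ => hg.contDiffAt.differentiableAt (by simp))
  · exact (hf'.mul hg.continuous).integrable_of_hasCompactSupport (hfs.pd v).mul_right
  · exact (hf.continuous.mul hg').integrable_of_hasCompactSupport hfs.mul_right
  · exact (hf.continuous.mul hg.continuous).integrable_of_hasCompactSupport hfs.mul_right

lemma integral_mul_pd_self {f : ℂ → ℝ} (v : ℂ) (hf : ContDiff ℝ 1 f)
    (hfs : HasCompactSupport f) : ∫ z, f z * pd v f z = 0 := by
  have h := integral_mul_pd v hf hf hfs
  simp only [mul_comm (pd v f _)] at h
  linarith

lemma pd_pd_eq {f : ℂ → ℝ} {z : ℂ} (v w : ℂ) (hf : ContDiffAt ℝ 2 f z) :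
    pd v (pd w f) z = fderiv ℝ (fderiv ℝ f) z v w := by
  have hd : DifferentiableAt ℝ (fderiv ℝ f) z :=
    (hf.fderiv_right (m := 1) (by norm_num)).differentiableAt (by simp)
  change fderiv ℝ (fun y => fderiv ℝ f y w) z v = _
  rw [fderiv_clm_apply hd (differentiableAt_const w)]
  simp

lemma pd_comm {f : ℂ → ℝ} {z : ℂ} (v w : ℂ) (hf : ContDiffAt ℝ 2 f z) :
    pd v (pd w f) z = pd w (pd v f) z := by
  rw [pd_pd_eq v w hf, pd_pd_eq w v hf]
  exact (hf.isSymmSndFDerivAt (by simp)) v w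

/-- Multiplier form of the Carleman identity with a linear weight. -/
lemma carleman_identity {v : ℂ → ℝ} (K : ℝ) (hv : ContDiff ℝ 2 v) (hvs : HasCompactSupport v) :
    ∫ z, (lapC v z - 2 * K * pd 1 v z + K ^ 2 * v z) * pd 1 v z
      = -(2 * K) * ∫ z, pd 1 v z ^ 2 := by
  have hx : ContDiff ℝ 1 (pd 1 v) := contDiff_pd (n := 1) 1 hv
  have hy : ContDiff ℝ 1 (pd Complex.I v) := contDiff_pd (n := 1) _ hv
  have hxx : Continuous (pd 1 (pd 1 v)) := (contDiff_pd (n := 0) 1 hx).continuous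
  have hyy : Continuous (pd Complex.I (pd Complex.I v)) := (contDiff_pd (n := 0) _ hy).continuous
  have e1 : ∫ z, pd 1 v z * pd 1 (pd 1 v) z = 0 := integral_mul_pd_self 1 hx (hvs.pd 1)
  have e2 : ∫ z, pd 1 v z * pd Complex.I (pd Complex.I v) z = 0 := by
    rw [integral_mul_pd Complex.I hx hy (hvs.pd 1)]
    simp only [fun z => pd_comm (z := z) Complex.I 1 hv.contDiffAt]
    have := integral_mul_pd_self 1 hy (hvs.pd Complex.I)
    simp only [mul_comm (pd 1 (pd Complex.I v) _), this, neg_zero]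
  have e3 : ∫ z, v z * pd 1 v z = 0 := integral_mul_pd_self 1 (hv.of_le (by norm_num)) hvs
  have i1 : Integrable fun z => pd 1 v z * pd 1 (pd 1 v) z :=
    (hx.continuous.mul hxx).integrable_of_hasCompactSupport (hvs.pd 1).mul_right
  have i2 : Integrable fun z => pd 1 v z * pd Complex.I (pd Complex.I v) z :=
    (hx.continuous.mul hyy).integrable_of_hasCompactSupport (hvs.pd 1).mul_right
  have i3 : Integrable fun z => v z * pd 1 v z :=
    (hv.continuous.mul hx.continuous).integrable_of_hasCompactSupport hvs.mul_right
  have i4 : Integrable fun z => pd 1 v z ^ 2 := by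
    simp only [pow_two]
    exact (hx.continuous.mul hx.continuous).integrable_of_hasCompactSupport (hvs.pd 1).mul_right
  have : ∀ z, (lapC v z - 2 * K * pd 1 v z + K ^ 2 * v z) * pd 1 v z
      = (pd 1 v z * pd 1 (pd 1 v) z + pd 1 v z * pd Complex.I (pd Complex.I v) z)
        + (K ^ 2 * (v z * pd 1 v z) + (-(2 * K)) * (pd 1 v z ^ 2)) := by
    intro z; simp only [lapC]; ring
  simp only [this]
  rw [integral_add (f := fun z => _ + _) (i1.add i2)
      (g := fun z => _ + _) ((i3.const_mul _).add (i4.const_mul _)), integral_add i1 i2,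
    integral_add (i3.const_mul _) (i4.const_mul _), integral_const_mul, integral_const_mul,
    e1, e2, e3]
  ring

/-- A one-directional Poincaré inequality. -/
lemma integral_sq_le_of_support {v : ℂ → ℝ} {ρ : ℝ} (hv : ContDiff ℝ 1 v)
    (hvs : HasCompactSupport v) (hsupp : ∀ z, ρ < ‖z‖ → v z = 0) :
    ∫ z, v z ^ 2 ≤ 4 * ρ ^ 2 * ∫ z, pd 1 v z ^ 2 := by
  have hx : Continuous (pd 1 v) := (contDiff_pd (n := 0) 1 hv).continuous
  have i1 : Integrable fun z => v z ^ 2 :=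
    (hv.continuous.pow 2).integrable_of_hasCompactSupport (by
      simpa only [pow_two] using! hvs.mul_right)
  have i2 : Integrable fun z => pd 1 v z ^ 2 :=
    (hx.pow 2).integrable_of_hasCompactSupport (by
      simpa only [pow_two] using! (hvs.pd 1).mul_right)
  have hre : ∀ z, pd 1 (fun w : ℂ => w.re) z = 1 := by
    intro z
    change fderiv ℝ (fun w : ℂ => Complex.reCLM w) z 1 = 1
    rw [ContinuousLinearMap.fderiv]; simp
  have h := integral_mul_pd (f := fun z => v z * v z) (g := fun z => z.re) 1 (hv.mul hv)
    Complex.reCLM.contDiff hvs.mul_right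
  have hd : ∀ z, pd 1 (fun z => v z * v z) z = 2 * (v z * pd 1 v z) := by
    intro z
    have hvd := hv.contDiffAt.differentiableAt (x := z) (by simp)
    rw [pd_mul 1 hvd hvd]; ring
  simp only [hre, hd, mul_one] at h
  have i3 : Integrable fun z => 2 * (v z * pd 1 v z) * z.re :=
    Continuous.integrable_of_hasCompactSupport
      (((continuous_const.mul (hv.continuous.mul hx)).mul Complex.continuous_re))
      ((hvs.mul_right (f' := pd 1 v)).mul_left (f := fun _ => (2 : ℝ))).mul_right
  have hle : ∫ z, -(2 * (v z * pd 1 v z) * z.re)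
      ≤ ∫ z, (1/2 * v z ^ 2 + 2 * ρ ^ 2 * pd 1 v z ^ 2) := by
    refine integral_mono i3.neg ((i1.const_mul _).add (i2.const_mul _)) fun z => ?_
    by_cases hz : ρ < ‖z‖
    · simp only [hsupp z hz]; nlinarith [mul_nonneg (sq_nonneg ρ) (sq_nonneg (pd 1 v z))]
    · have h1 : |z.re| ≤ ρ := (Complex.abs_re_le_norm z).trans (not_lt.1 hz)
      have h2 : z.re ^ 2 ≤ ρ ^ 2 := by rw [← sq_abs]; gcongr
      have h3 := mul_le_mul_of_nonneg_right h2 (sq_nonneg (pd 1 v z))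
      simp only
      nlinarith [sq_nonneg (v z + 2 * (pd 1 v z * z.re))]
  rw [integral_neg, ← h, integral_add (i1.const_mul _) (i2.const_mul _), integral_const_mul,
    integral_const_mul] at hle
  simp only [← pow_two] at hle
  linarith

/-- The exponential weight in the real direction. -/
def expWeight (K : ℝ) (z : ℂ) : ℝ := Real.exp (K * z.re)

lemma contDiff_expWeight (K : ℝ) {n : ℕ} : ContDiff ℝ n (expWeight K) :=
  (contDiff_const.mul Complex.reCLM.contDiff).exp

lemma pd_expWeight (K : ℝ) (v z : ℂ) : pd v (expWeight K) z = K * v.re * expWeight K z := by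
  have h : HasFDerivAt (expWeight K) (Real.exp (K * z.re) • (K • Complex.reCLM)) z :=
    ((Complex.reCLM.hasFDerivAt (x := z)).const_mul K).exp
  simp only [pd, h.fderiv, expWeight]
  simp; ring

lemma pd_one_expWeight_mul {u : ℂ → ℝ} {z : ℂ} (K : ℝ) (hu : DifferentiableAt ℝ u z) :
    pd 1 (fun w => expWeight K w * u w) z = expWeight K z * (pd 1 u z + K * u z) := by
  rw [pd_mul 1 ((contDiff_expWeight K (n := 1)).differentiable (by simp) z) hu, pd_expWeight]
  simp; ring

lemma lapC_expWeight (K : ℝ) (z : ℂ) : lapC (expWeight K) z = K ^ 2 * expWeight K z := by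
  have h : ∀ v : ℂ, pd v (expWeight K) = fun z => (K * v.re) * expWeight K z := fun v => by
    ext z; rw [pd_expWeight]
  have h2 : ∀ v : ℂ, pd v (pd v (expWeight K)) z = (K * v.re) ^ 2 * expWeight K z := by
    intro v
    rw [h v, pd_mul v (differentiableAt_const _)
      ((contDiff_expWeight K (n := 1)).differentiable (by simp) z), pd_expWeight]
    simp [pd]; ring
  simp [lapC, h2]

lemma lapC_expWeight_mul {u : ℂ → ℝ} {z : ℂ} (K : ℝ) (hu : ContDiffAt ℝ 2 u z) :
    lapC (fun w => expWeight K w * u w) z - 2 * K * pd 1 (fun w => expWeight K w * u w) z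
      + K ^ 2 * (expWeight K z * u z) = expWeight K z * lapC u z := by
  rw [lapC_mul (contDiff_expWeight K (n := 2)).contDiffAt hu, pd_one_expWeight_mul K
    (hu.differentiableAt (by simp)), lapC_expWeight, pd_expWeight, pd_expWeight]
  simp; ring

lemma lapC_abs_integrand_integrable {u : ℂ → ℝ} (K : ℝ) (hu : ContDiff ℝ 2 u)
    (hus : HasCompactSupport u) :
    Integrable fun z => |lapC u z| * |pd 1 u z + K * u z| * expWeight K z ^ 2 := by
  have hx : ContDiff ℝ 1 (pd 1 u) := contDiff_pd (n := 1) 1 hu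
  have hy : ContDiff ℝ 1 (pd Complex.I u) := contDiff_pd (n := 1) _ hu
  have hxx : Continuous (pd 1 (pd 1 u)) := (contDiff_pd (n := 0) 1 hx).continuous
  have hyy : Continuous (pd Complex.I (pd Complex.I u)) := (contDiff_pd (n := 0) _ hy).continuous
  have hl : Continuous (lapC u) := hxx.add hyy
  have hw : Continuous (expWeight K) := (contDiff_expWeight K (n := 0)).continuous
  have hs : HasCompactSupport fun z => |pd 1 u z + K * u z| :=
    ((hus.pd 1).add (hus.mul_left (f := fun _ => K))).norm
  exact ((hl.abs.mul (hx.continuous.add (continuous_const.mul hu.continuous)).abs).mul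
    (hw.pow 2)).integrable_of_hasCompactSupport (hs.mul_left.mul_right)

/-- Carleman inequality with a linear weight. -/
lemma carleman_inequality {u : ℂ → ℝ} (K : ℝ) (hu : ContDiff ℝ 2 u) (hus : HasCompactSupport u) :
    2 * K * ∫ z, (expWeight K z * (pd 1 u z + K * u z)) ^ 2
      ≤ ∫ z, |lapC u z| * |pd 1 u z + K * u z| * expWeight K z ^ 2 := by
  have h := carleman_identity (v := fun w => expWeight K w * u w) K
    ((contDiff_expWeight K (n := 2)).mul hu) hus.mul_left
  have hd : ∀ z, DifferentiableAt ℝ u z := fun z => hu.contDiffAt.differentiableAt (by simp)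
  simp only [fun z => lapC_expWeight_mul (z := z) K hu.contDiffAt] at h
  simp only [fun z => pd_one_expWeight_mul K (hd z)] at h
  have e : 2 * K * ∫ z, (expWeight K z * (pd 1 u z + K * u z)) ^ 2
      = -∫ z, expWeight K z * lapC u z * (expWeight K z * (pd 1 u z + K * u z)) := by
    rw [h]; ring
  rw [e]
  refine (neg_le_abs _).trans (abs_integral_le_integral_abs.trans (le_of_eq ?_))
  congr 1
  ext z
  have : 0 < expWeight K z := Real.exp_pos _
  simp only [abs_mul, abs_of_pos this]
  ring

open InnerProductSpace in
lemma harnack_ball {f : ℂ → ℝ} {z w : ℂ} {r : ℝ} (hf : HarmonicOnNhd f (closedBall z r))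
    (hpos : ∀ x ∈ closedBall z r, 0 ≤ f x) (hw : w ∈ ball z r) :
    (r - ‖w - z‖) / (r + ‖w - z‖) * f z ≤ f w ∧ f w ≤ (r + ‖w - z‖) / (r - ‖w - z‖) * f z := by
  have hr : 0 < r := pos_of_mem_ball hw
  have e1 := hf.circleAverage_re_herglotzRieszKernel_smul hw
  have e2 : Real.circleAverage f z r = f z :=
    InnerProductSpace.HarmonicOnNhd.circleAverage_eq (by rwa [abs_of_pos hr])
  have hc : ContinuousOn f (sphere z |r|) := by
    rw [abs_of_pos hr]; exact hf.continuousOn.mono sphere_subset_closedBall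
  have hk : ContinuousOn (Complex.re ∘ herglotzRieszKernel z w) (sphere z |r|) :=
    Complex.continuous_re.comp_continuousOn (continuousOn_herglotzRieszKernel_sphere hw)
  have i1 : CircleIntegrable f z r := ContinuousOn.circleIntegrable' hc
  have i2 : CircleIntegrable ((Complex.re ∘ herglotzRieszKernel z w) • f) z r :=
    ContinuousOn.circleIntegrable' (hk.smul hc)
  have i3 : ∀ a : ℝ, CircleIntegrable (fun x => a • f x) z r := fun a =>
    ContinuousOn.circleIntegrable' (hc.const_smul a)
  have hp : ∀ x ∈ sphere z |r|, x ∈ sphere z r ∧ 0 ≤ f x := fun x hx => by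
    rw [abs_of_pos hr] at hx
    exact ⟨hx, hpos x (sphere_subset_closedBall hx)⟩
  constructor
  · rw [← e1]
    nth_rewrite 1 [← e2]
    rw [← smul_eq_mul, ← Real.circleAverage_fun_smul]
    refine Real.circleAverage_mono (i3 _) i2 fun x hx => ?_
    obtain ⟨hx, h0⟩ := hp x hx
    exact mul_le_mul_of_nonneg_right (le_re_herglotzRieszKernel hx hw) h0
  · rw [← e1]
    nth_rewrite 1 [← e2]
    rw [← smul_eq_mul, ← Real.circleAverage_fun_smul]
    refine Real.circleAverage_mono i2 (i3 _) fun x hx => ?_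
    obtain ⟨hx, h0⟩ := hp x hx
    exact mul_le_mul_of_nonneg_right (re_herglotzRieszKernel_le hx hw) h0

open InnerProductSpace in
lemma norm_fderiv_le_of_nonneg {f : ℂ → ℝ} {z : ℂ} {r : ℝ} (hr : 0 < r)
    (hf : HarmonicOnNhd f (closedBall z r)) (hpos : ∀ x ∈ closedBall z r, 0 ≤ f x) :
    ‖fderiv ℝ f z‖ ≤ 4 / r * f z := by
  have hz : 0 ≤ f z := hpos z (mem_closedBall_self hr.le)
  refine norm_fderiv_le_of_lip' ℝ (by positivity) ?_
  filter_upwards [ball_mem_nhds z (half_pos hr)] with w hw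
  rw [mem_ball_iff_norm] at hw
  have hn := norm_nonneg (w - z)
  obtain ⟨h1, h2⟩ := harnack_ball hf hpos (w := w) (by rw [mem_ball_iff_norm]; linarith)
  set ρ := ‖w - z‖
  have h3 : (r + ρ) / (r - ρ) ≤ 1 + 4 / r * ρ := by
    rw [div_le_iff₀ (by linarith)]
    field_simp
    nlinarith
  have h4 : 1 - 4 / r * ρ ≤ (r - ρ) / (r + ρ) := by
    rw [le_div_iff₀ (by linarith)]
    field_simp
    nlinarith
  have h5 := mul_le_mul_of_nonneg_right h3 hz
  have h6 := mul_le_mul_of_nonneg_right h4 hz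
  rw [Real.norm_eq_abs, abs_le]
  constructor <;> nlinarith

open InnerProductSpace in
lemma norm_fderiv_le_of_abs_le {f : ℂ → ℝ} {z : ℂ} {r B : ℝ} (hr : 0 < r)
    (hf : HarmonicOnNhd f (closedBall z r)) (hB : ∀ x ∈ closedBall z r, |f x| ≤ B) :
    ‖fderiv ℝ f z‖ ≤ 8 / r * B := by
  have h := norm_fderiv_le_of_nonneg (f := (fun _ => B) + f) hr
    ((harmonicOnNhd_const B).add hf) fun x hx => by
      have := neg_le_of_abs_le (hB x hx)
      simp only [Pi.add_apply]; linarith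
  have hz := le_of_abs_le (hB z (mem_closedBall_self hr.le))
  have e : fderiv ℝ ((fun _ => B) + f) z = fderiv ℝ f z := by
    change fderiv ℝ (fun x => B + f x) z = _
    rw [fderiv_const_add]
  rw [e] at h
  refine h.trans ?_
  have : 8 / r * B = 4 / r * (B + B) := by ring
  rw [this]
  simp only [Pi.add_apply]
  gcongr

/-- The open annulus around `c` with radii `1` and `5`. -/
def annulus (c : ℂ) : Set ℂ := {z | 1 < ‖z - c‖ ∧ ‖z - c‖ < 5}

lemma closedBall_subset_annulus {c z : ℂ} (h1 : 2 ≤ ‖z - c‖) (h2 : ‖z - c‖ ≤ 4) :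
    closedBall z (1 / 2) ⊆ annulus c := by
  intro w hw
  rw [mem_closedBall_iff_norm] at hw
  have e1 : ‖w - c‖ ≤ ‖w - z‖ + ‖z - c‖ := norm_sub_le_norm_sub_add_norm_sub w z c
  have e2 : ‖z - c‖ ≤ ‖z - w‖ + ‖w - c‖ := norm_sub_le_norm_sub_add_norm_sub z w c
  rw [norm_sub_rev z w] at e2
  constructor <;> linarith

open InnerProductSpace in
lemma harnack_step {f : ℂ → ℝ} {c z w : ℂ} (hf : HarmonicOnNhd f (annulus c))
    (hpos : ∀ x ∈ annulus c, 0 ≤ f x) (h1 : 2 ≤ ‖z - c‖) (h2 : ‖z - c‖ ≤ 4)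
    (hw : ‖w - z‖ ≤ 1 / 4) : f w ≤ 3 * f z := by
  have hs := closedBall_subset_annulus h1 h2
  have h0 := hpos z (hs (mem_closedBall_self (by norm_num)))
  refine (harnack_ball (hf.mono hs) (fun x hx => hpos x (hs hx))
    (by rw [mem_ball_iff_norm]; linarith)).2.trans ?_
  gcongr
  rw [div_le_iff₀ (by linarith)]
  linarith

lemma exists_log_annulus {z : ℂ} (h1 : 2 ≤ ‖z‖) (h2 : ‖z‖ ≤ 4) :
    ∃ a : ℂ, Complex.exp a = z ∧ a.re ∈ Icc (Real.log 2) (Real.log 4) ∧ |a.im| ≤ 4 := by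
  have h0 : z ≠ 0 := by rintro rfl; norm_num at h1
  refine ⟨Complex.log z, Complex.exp_log h0, ?_, ?_⟩
  · rw [Complex.log_re]
    exact ⟨Real.log_le_log (by norm_num) h1, Real.log_le_log (by linarith) h2⟩
  · rw [Complex.log_im]
    exact (Complex.abs_arg_le_pi z).trans Real.pi_le_four

open InnerProductSpace in
lemma exists_harnack_annulus : ∃ C : ℝ, 1 ≤ C ∧ ∀ (f : ℂ → ℝ) (c z w : ℂ),
    HarmonicOnNhd f (annulus c) → (∀ x ∈ annulus c, 0 ≤ f x) →
    2 ≤ ‖z - c‖ → ‖z - c‖ ≤ 4 → 2 ≤ ‖w - c‖ → ‖w - c‖ ≤ 4 → f w ≤ C * f z := by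
  refine ⟨3 ^ 1000, one_le_pow₀ (by norm_num), fun f c z w hf hpos hz1 hz2 hw1 hw2 => ?_⟩
  obtain ⟨a, ha, ha1, ha2⟩ := exists_log_annulus hz1 hz2
  obtain ⟨b, hb, hb1, hb2⟩ := exists_log_annulus hw1 hw2
  set p : ℕ → ℂ := fun k => a + (k / 1000 : ℝ) * (b - a) with hp
  have hstep : ∀ k, p (k + 1) = p k + (1 / 1000 : ℝ) * (b - a) := fun k => by
    simp only [hp]; push_cast; ring
  have hre : ∀ k ≤ 1000, (p k).re ∈ Icc (Real.log 2) (Real.log 4) := by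
    intro k hk
    have hk' : (k / 1000 : ℝ) ≤ 1 := by
      rw [div_le_one (by norm_num)]; exact_mod_cast hk
    have hk0 : (0 : ℝ) ≤ k / 1000 := by positivity
    have : (p k).re = (1 - (k / 1000 : ℝ)) * a.re + (k / 1000 : ℝ) * b.re := by
      simp only [hp, Complex.add_re, Complex.re_ofReal_mul, Complex.sub_re]; ring
    rw [this]
    exact convex_Icc _ _ ha1 hb1 (by linarith) hk0 (by ring)
  have hlog : Real.log 4 ≤ 2 := by
    have := Real.log_le_sub_one_of_pos (show (0:ℝ) < 4 by norm_num)
    have h2 : Real.log 4 = 2 * Real.log 2 := by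
      rw [show (4:ℝ) = 2 ^ 2 by norm_num, Real.log_pow]; norm_num
    have h3 := Real.log_le_sub_one_of_pos (show (0:ℝ) < 2 by norm_num)
    linarith
  have hlog0 : 0 ≤ Real.log 2 := Real.log_nonneg (by norm_num)
  have hba : ‖b - a‖ ≤ 10 := by
    refine (Complex.norm_le_abs_re_add_abs_im _).trans ?_
    have e1 : |(b - a).re| ≤ 2 := by
      rw [Complex.sub_re, abs_le]; constructor <;> linarith [ha1.1, ha1.2, hb1.1, hb1.2]
    have e2 : |(b - a).im| ≤ 8 := by
      rw [Complex.sub_im]; exact (abs_sub _ _).trans (by linarith)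
    linarith
  have hd : ‖((1 / 1000 : ℝ) : ℂ) * (b - a)‖ ≤ 1 / 100 := by
    rw [norm_mul, Complex.norm_real, Real.norm_of_nonneg (by norm_num)]; linarith
  have hnorm : ∀ k ≤ 1000, 2 ≤ ‖Complex.exp (p k)‖ ∧ ‖Complex.exp (p k)‖ ≤ 4 := by
    intro k hk
    rw [Complex.norm_exp]
    obtain ⟨h1, h2⟩ := hre k hk
    exact ⟨(Real.log_le_iff_le_exp (by norm_num)).1 h1, (Real.le_log_iff_exp_le (by norm_num)).1 h2⟩
  have main : ∀ k ≤ 1000, f (c + Complex.exp (p k)) ≤ 3 ^ k * f z := by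
    intro k
    induction k with
    | zero => intro _; simp [hp, ha]
    | succ k ih =>
      intro hk
      obtain ⟨n1, n2⟩ := hnorm k (by omega)
      have := harnack_step (z := c + Complex.exp (p k)) (w := c + Complex.exp (p (k + 1))) hf hpos
        (by simpa using n1) (by simpa using n2) ?_
      · refine this.trans ?_
        rw [pow_succ']
        linarith [ih (by omega)]
      · rw [hstep, Complex.exp_add, add_sub_add_left_eq_sub, ← mul_sub_one, norm_mul]
        have := Complex.norm_exp_sub_one_le (hd.trans (by norm_num))
        calc _ ≤ 4 * (2 * ‖((1 / 1000 : ℝ) : ℂ) * (b - a)‖) := by gcongr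
          _ ≤ 1 / 4 := by linarith
  have := main 1000 le_rfl
  have hlast : c + Complex.exp (p 1000) = w := by
    have : p 1000 = b := by simp [hp]
    rw [this, hb]; ring
  rwa [hlast] at this

open InnerProductSpace in
lemma exists_harnack_annulus_abs : ∃ C : ℝ, 1 ≤ C ∧ ∀ (f : ℂ → ℝ) (c : ℂ),
    HarmonicOnNhd f (annulus c) →
    ((∀ x ∈ annulus c, 0 ≤ f x) ∨ (∀ x ∈ annulus c, f x ≤ 0)) →
    (∀ z w, 2 ≤ ‖z - c‖ → ‖z - c‖ ≤ 4 → 2 ≤ ‖w - c‖ → ‖w - c‖ ≤ 4 → |f w| ≤ C * |f z|) ∧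
    ∀ z, 2 ≤ ‖z - c‖ → ‖z - c‖ ≤ 4 → ‖fderiv ℝ f z‖ ≤ C * |f z| := by
  obtain ⟨C, hC1, hC⟩ := exists_harnack_annulus
  have key : ∀ (f : ℂ → ℝ) (c : ℂ), HarmonicOnNhd f (annulus c) → (∀ x ∈ annulus c, 0 ≤ f x) →
      (∀ z w, 2 ≤ ‖z - c‖ → ‖z - c‖ ≤ 4 → 2 ≤ ‖w - c‖ → ‖w - c‖ ≤ 4 → |f w| ≤ (C + 8) * |f z|) ∧
      ∀ z, 2 ≤ ‖z - c‖ → ‖z - c‖ ≤ 4 → ‖fderiv ℝ f z‖ ≤ (C + 8) * |f z| := by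
    intro f c hf hpos
    have hself : ∀ z, 2 ≤ ‖z - c‖ → ‖z - c‖ ≤ 4 → z ∈ annulus c := fun z h1 h2 =>
      closedBall_subset_annulus h1 h2 (mem_closedBall_self (by norm_num))
    constructor
    · intro z w h1 h2 h3 h4
      rw [abs_of_nonneg (hpos _ (hself z h1 h2)), abs_of_nonneg (hpos _ (hself w h3 h4))]
      linarith [hC f c z w hf hpos h1 h2 h3 h4, hpos _ (hself z h1 h2)]
    · intro z h1 h2
      have hs := closedBall_subset_annulus h1 h2
      have := norm_fderiv_le_of_nonneg (by norm_num) (hf.mono hs) fun x hx => hpos x (hs hx)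
      rw [abs_of_nonneg (hpos _ (hself z h1 h2))]
      refine this.trans ?_
      have := hpos _ (hself z h1 h2)
      gcongr
      norm_num
      linarith
  refine ⟨C + 8, by linarith, fun f c hf hs => ?_⟩
  rcases hs with hs | hs
  · exact key f c hf hs
  · have := key (-f) c hf.neg fun x hx => by simpa using hs x hx
    simpa [fderiv_neg] using this

/-- `f` is twice continuously differentiable at `z`, with value, first partial derivatives and
Laplacian at `z` bounded by `B`. -/
def C2Bound (f : ℂ → ℝ) (z : ℂ) (B : ℝ) : Prop :=
  ContDiffAt ℝ 2 f z ∧ |f z| ≤ B ∧ |pd 1 f z| ≤ B ∧ |pd Complex.I f z| ≤ B ∧ |lapC f z| ≤ B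

lemma C2Bound.congr {f g : ℂ → ℝ} {z : ℂ} {B : ℝ} (hf : C2Bound f z B) (h : g =ᶠ[𝓝 z] f) :
    C2Bound g z B := by
  obtain ⟨h1, h2, h3, h4, h5⟩ := hf
  refine ⟨h1.congr_of_eventuallyEq h, ?_, ?_, ?_, ?_⟩
  · rwa [h.eq_of_nhds]
  · rwa [(pd_eventuallyEq _ h).eq_of_nhds]
  · rwa [(pd_eventuallyEq _ h).eq_of_nhds]
  · rwa [lapC_congr h]

lemma C2Bound.mono {f : ℂ → ℝ} {z : ℂ} {B B' : ℝ} (hf : C2Bound f z B) (h : B ≤ B') :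
    C2Bound f z B' :=
  ⟨hf.1, hf.2.1.trans h, hf.2.2.1.trans h, hf.2.2.2.1.trans h, hf.2.2.2.2.trans h⟩

lemma abs_mul_le_of_le {a b A B : ℝ} (ha : |a| ≤ A) (hb : |b| ≤ B) : |a * b| ≤ A * B := by
  rw [abs_mul]
  exact mul_le_mul ha hb (abs_nonneg _) ((abs_nonneg _).trans ha)

lemma C2Bound.mul {f g : ℂ → ℝ} {z : ℂ} {A B : ℝ} (hf : C2Bound f z A) (hg : C2Bound g z B) :
    C2Bound (fun w => f w * g w) z (6 * (A * B)) := by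
  obtain ⟨f1, f2, f3, f4, f5⟩ := hf
  obtain ⟨g1, g2, g3, g4, g5⟩ := hg
  have hA : 0 ≤ A := (abs_nonneg _).trans f2
  have hB : 0 ≤ B := (abs_nonneg _).trans g2
  have hAB := mul_nonneg hA hB
  refine ⟨f1.mul g1, (abs_mul_le_of_le f2 g2).trans (by linarith), ?_, ?_, ?_⟩
  · rw [pd_mul _ (f1.differentiableAt (by simp)) (g1.differentiableAt (by simp))]
    have e1 := abs_le.1 (abs_mul_le_of_le f2 g3)
    have e2 := abs_le.1 (abs_mul_le_of_le f3 g2)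
    rw [abs_le]; constructor <;> linarith
  · rw [pd_mul _ (f1.differentiableAt (by simp)) (g1.differentiableAt (by simp))]
    have e1 := abs_le.1 (abs_mul_le_of_le f2 g4)
    have e2 := abs_le.1 (abs_mul_le_of_le f4 g2)
    rw [abs_le]; constructor <;> linarith
  · rw [lapC_mul f1 g1]
    have e1 := abs_le.1 (abs_mul_le_of_le f2 g5)
    have e2 := abs_le.1 (abs_mul_le_of_le f5 g2)
    have e3 := abs_le.1 (abs_mul_le_of_le f3 g3)
    have e4 := abs_le.1 (abs_mul_le_of_le f4 g4)
    rw [abs_le]; constructor <;> linarith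

lemma exists_c2Bound {f : ℂ → ℝ} (hf : ContDiff ℝ 2 f) (hs : HasCompactSupport f) :
    ∃ B, ∀ z, C2Bound f z B := by
  have hx : ContDiff ℝ 1 (pd 1 f) := contDiff_pd (n := 1) 1 hf
  have hy : ContDiff ℝ 1 (pd Complex.I f) := contDiff_pd (n := 1) _ hf
  have hxx : Continuous (pd 1 (pd 1 f)) := (contDiff_pd (n := 0) 1 hx).continuous
  have hyy : Continuous (pd Complex.I (pd Complex.I f)) := (contDiff_pd (n := 0) _ hy).continuous
  obtain ⟨B1, h1⟩ := hs.exists_bound_of_continuous hf.continuous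
  obtain ⟨B2, h2⟩ := (hs.pd 1).exists_bound_of_continuous hx.continuous
  obtain ⟨B3, h3⟩ := (hs.pd Complex.I).exists_bound_of_continuous hy.continuous
  obtain ⟨B4, h4⟩ := (((hs.pd 1).pd 1).add ((hs.pd Complex.I).pd
    Complex.I)).exists_bound_of_continuous (hxx.add hyy)
  refine ⟨max (max B1 B2) (max B3 B4), fun z => ⟨hf.contDiffAt, ?_, ?_, ?_, ?_⟩⟩
  · exact (h1 z).trans (by simp)
  · exact (h2 z).trans (by simp)
  · exact (h3 z).trans (by simp)
  · exact (h4 z).trans (by simp)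

lemma C2Bound.comp_sub {f : ℂ → ℝ} {c z : ℂ} {B : ℝ} (hf : C2Bound f (z - c) B) :
    C2Bound (fun w => f (w - c)) z B := by
  have h : ∀ (v : ℂ) (g : ℂ → ℝ), pd v (fun w => g (w - c)) = fun w => pd v g (w - c) := by
    intro v g; ext w; simp only [pd, fderiv_comp_sub]
  obtain ⟨h1, h2, h3, h4, h5⟩ := hf
  refine ⟨h1.comp (f := fun w => w - c) z (by fun_prop), h2, ?_, ?_, ?_⟩
  · rwa [h]
  · rwa [h]
  · simpa only [lapC, h] using h5

lemma C2Bound.comp_smul {f : ℂ → ℝ} {z : ℂ} {a B : ℝ} (ha : 0 ≤ a) (ha1 : a ≤ 1)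
    (hf : C2Bound f (a • z) B) : C2Bound (fun w => f (a • w)) z B := by
  have h : ∀ (v : ℂ) (g : ℂ → ℝ) (w : ℂ), pd v (fun w => g (a • w)) w = a * pd v g (a • w) := by
    intro v g w
    simp only [pd, fderiv_comp_smul, _root_.smul_apply, smul_eq_mul]
  have h' : ∀ (v : ℂ) (w : ℂ),
      pd v (pd v (fun w => f (a • w))) w = a ^ 2 * pd v (pd v f) (a • w) := by
    intro v w
    rw [funext (h v f)]
    have : pd v (fun w => a * pd v f (a • w)) w = a * pd v (fun w => pd v f (a • w)) w :=
      congrArg (fun g => g w v) (fderiv_const_smul_field (𝕜 := ℝ)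
        (f := fun w : ℂ => pd v f (a • w)) a)
    rw [this, h]; ring
  obtain ⟨h1, h2, h3, h4, h5⟩ := hf
  have h0 : 0 ≤ B := (abs_nonneg _).trans h2
  refine ⟨h1.comp (f := fun w => a • w) z (by fun_prop), h2, ?_, ?_, ?_⟩
  · rw [h]
    exact (abs_mul_le_of_le ((abs_of_nonneg ha).trans_le ha1) h3).trans (by simp)
  · rw [h]
    exact (abs_mul_le_of_le ((abs_of_nonneg ha).trans_le ha1) h4).trans (by simp)
  · simp only [lapC, h'] at h5 ⊢
    rw [← mul_add]
    have : |a ^ 2| ≤ 1 := by rw [abs_of_nonneg (by positivity)]; exact pow_le_one₀ ha ha1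
    exact (abs_mul_le_of_le this h5).trans (by simp)

lemma C2Bound.one_sub {f : ℂ → ℝ} {z : ℂ} {B : ℝ} (hf : C2Bound f z B) :
    C2Bound (fun w => 1 - f w) z (1 + B) := by
  have h : ∀ (v : ℂ) (g : ℂ → ℝ), pd v (fun w => 1 - g w) = fun w => - pd v g w := by
    intro v g; ext w; simp [pd, fderiv_const_sub]
  have h2' : ∀ (v : ℂ) (g : ℂ → ℝ), pd v (fun w => - g w) = fun w => - pd v g w := by
    intro v g; ext w; simp [pd, fderiv_fun_neg]
  obtain ⟨h1, h2, h3, h4, h5⟩ := hf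
  refine ⟨contDiffAt_const.sub h1, ?_, ?_, ?_, ?_⟩
  · exact (abs_sub _ _).trans (by simpa using h2)
  · rw [h, abs_neg]; linarith
  · rw [h, abs_neg]; linarith
  · simp only [lapC, h, h2'] at h5 ⊢
    rw [← neg_add, abs_neg]; linarith

/-- A radial cutoff: `1` on the disk of radius `2`, supported in the disk of radius `5 / 2`. -/
def diskBump : ContDiffBump (0 : ℂ) := ⟨2, 5 / 2, by norm_num, by norm_num⟩

/-- A radial cutoff: `1` on the disk of radius `1 / 4`, supported in the disk of radius `1 / 2`. -/
def outerBump : ContDiffBump (0 : ℂ) := ⟨1 / 4, 1 / 2, by norm_num, by norm_num⟩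

/-- The cutoff vanishing on the disks of radius `2` around the points `c j`, `j ∈ J`. -/
def diskCutoff {ι : Type} (c : ι → ℂ) (J : Finset ι) (z : ℂ) : ℝ :=
  ∏ j ∈ J, (1 - diskBump (z - c j))

/-- The cutoff vanishing near the punctures and outside of the disk of radius `R / 2`. -/
def fullCutoff {ι : Type} (c : ι → ℂ) (J : Finset ι) (R : ℝ) (z : ℂ) : ℝ :=
  outerBump (R⁻¹ • z) * diskCutoff c J z

lemma diskBump_eq_one {z : ℂ} (hz : ‖z‖ ≤ 2) : diskBump z = 1 :=
  diskBump.one_of_mem_closedBall (by simpa [diskBump] using hz)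

lemma diskBump_eq_zero {z : ℂ} (hz : 5 / 2 ≤ ‖z‖) : diskBump z = 0 :=
  diskBump.zero_of_le_dist (by simpa [diskBump] using hz)

lemma outerBump_eq_one {R : ℝ} {z : ℂ} (hR : 0 < R) (hz : ‖z‖ ≤ R / 4) :
    outerBump (R⁻¹ • z) = 1 := by
  refine outerBump.one_of_mem_closedBall ?_
  rw [mem_closedBall_zero_iff, norm_smul, Real.norm_of_nonneg (by positivity),
    inv_mul_le_iff₀ hR]
  simp only [outerBump]; linarith

lemma outerBump_eq_zero {R : ℝ} {z : ℂ} (hR : 0 < R) (hz : R / 2 ≤ ‖z‖) :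
    outerBump (R⁻¹ • z) = 0 := by
  refine outerBump.zero_of_le_dist ?_
  rw [dist_zero_right, norm_smul, Real.norm_of_nonneg (by positivity), le_inv_mul_iff₀ hR]
  simp only [outerBump]; linarith

/-- The points `c j` are at distance at least `1000` from each other. -/
def Separated {ι : Type} (c : ι → ℂ) : Prop := ∀ i j, i ≠ j → 1000 ≤ ‖c i - c j‖

lemma Separated.le_norm_sub {ι : Type} {c : ι → ℂ} (hc : Separated c) {i j : ι} (hij : i ≠ j)
    {z : ℂ} {a : ℝ} (hz : ‖z - c j‖ ≤ a) : 1000 - a ≤ ‖z - c i‖ := by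
  have h1 := hc i j hij
  have h2 : ‖c i - c j‖ ≤ ‖c i - z‖ + ‖z - c j‖ := norm_sub_le_norm_sub_add_norm_sub _ _ _
  rw [norm_sub_rev (c i) z] at h2
  linarith

lemma Separated.finite {ι : Type} {c : ι → ℂ} (hc : Separated c) (R : ℝ) :
    {j | ‖c j‖ < R}.Finite := by
  obtain ⟨t, -, htf, ht⟩ := (isCompact_closedBall (0 : ℂ) R).finite_cover_balls (e := 1) one_pos
  refine (htf.biUnion (t := fun x => {j | c j ∈ ball x 1}) fun x _ =>
    Set.Subsingleton.finite ?_).subset fun j hj => ?_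
  · intro i hi j hj
    by_contra hij
    have h1 := hc i j hij
    have h2 := dist_triangle_right (c i) (c j) x
    have h3 := mem_ball.1 hi
    have h4 := mem_ball.1 hj
    rw [← dist_eq_norm] at h1
    linarith
  · have hm : c j ∈ closedBall (0 : ℂ) R := by
      rw [mem_closedBall_zero_iff]; exact le_of_lt hj
    simpa using ht hm

lemma diskCutoff_eventuallyEq {ι : Type} {c : ι → ℂ} (hc : Separated c) {J : Finset ι} {j : ι}
    (hj : j ∈ J) {z : ℂ} (hz : ‖z - c j‖ ≤ 5) :
    diskCutoff c J =ᶠ[𝓝 z] fun w => 1 - diskBump (w - c j) := by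
  filter_upwards [ball_mem_nhds z one_pos] with w hw
  refine Finset.prod_eq_single j (fun i _ hij => ?_) (fun h => absurd hj h)
  rw [mem_ball_iff_norm] at hw
  have h1 : ‖w - c j‖ ≤ 6 :=
    (norm_sub_le_norm_sub_add_norm_sub w z (c j)).trans (by linarith)
  have := hc.le_norm_sub hij h1
  rw [diskBump_eq_zero (by linarith), sub_zero]

lemma diskCutoff_eventuallyEq_one {ι : Type} {c : ι → ℂ} {J : Finset ι} {z : ℂ}
    (hz : ∀ j ∈ J, 5 / 2 < ‖z - c j‖) : diskCutoff c J =ᶠ[𝓝 z] fun _ => 1 := by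
  have : ∀ᶠ w in 𝓝 z, ∀ j ∈ J, 5 / 2 < ‖w - c j‖ := by
    rw [Filter.eventually_all_finset]
    intro j hj
    exact (continuousAt_id.sub continuousAt_const).norm.eventually (lt_mem_nhds (hz j hj))
  filter_upwards [this] with w hw
  exact Finset.prod_eq_one fun j hj => by rw [diskBump_eq_zero (hw j hj).le, sub_zero]

lemma exists_cutoff_bound : ∃ A : ℝ, 1 ≤ A ∧ ∀ (ι : Type) (c : ι → ℂ) (J : Finset ι) (R : ℝ)
    (z : ℂ), Separated c → 1 ≤ R → C2Bound (fullCutoff c J R) z A := by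
  obtain ⟨B1, h1⟩ := exists_c2Bound diskBump.contDiff diskBump.hasCompactSupport
  obtain ⟨B2, h2⟩ := exists_c2Bound outerBump.contDiff outerBump.hasCompactSupport
  have hB1 : 0 ≤ B1 := (abs_nonneg _).trans (h1 0).2.1
  have hB2 : 0 ≤ B2 := (abs_nonneg _).trans (h2 0).2.1
  have hd : ∀ (ι : Type) (c : ι → ℂ) (J : Finset ι) (z : ℂ), Separated c →
      C2Bound (diskCutoff c J) z (1 + B1) := by
    intro ι c J z hc
    by_cases hz : ∃ j ∈ J, ‖z - c j‖ ≤ 5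
    · obtain ⟨j, hj, hz⟩ := hz
      exact ((h1 (z - c j)).comp_sub.one_sub).congr (diskCutoff_eventuallyEq hc hj hz)
    · push Not at hz
      refine C2Bound.congr ?_ (diskCutoff_eventuallyEq_one fun j hj => by linarith [hz j hj])
      refine ⟨contDiffAt_const, ?_, ?_, ?_, ?_⟩
      · simpa using hB1
      all_goals
        have h0 : ∀ (v : ℂ) (a : ℝ), pd v (fun _ => a) = fun _ => 0 := by
          intro v a; ext w; simp [pd]
        simp only [lapC, h0]
        norm_num
        linarith
  refine ⟨1 + B1 + 6 * (B2 * (1 + B1)), by nlinarith [mul_nonneg hB2 hB1],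
    fun ι c J R z hc hR => ?_⟩
  exact (C2Bound.mul (((h2 (R⁻¹ • z)).comp_smul (by positivity) (inv_le_one_of_one_le₀ hR)))
    (hd ι c J z hc)).mono (by linarith)

/-- `C` is an admissible constant in the Harnack inequalities in annuli. -/
def HarnackConst (C : ℝ) : Prop :=
  1 ≤ C ∧ ∀ (f : ℂ → ℝ) (c : ℂ), InnerProductSpace.HarmonicOnNhd f (annulus c) →
    ((∀ x ∈ annulus c, 0 ≤ f x) ∨ (∀ x ∈ annulus c, f x ≤ 0)) →
    (∀ z w, 2 ≤ ‖z - c‖ → ‖z - c‖ ≤ 4 → 2 ≤ ‖w - c‖ → ‖w - c‖ ≤ 4 → |f w| ≤ C * |f z|) ∧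
    ∀ z, 2 ≤ ‖z - c‖ → ‖z - c‖ ≤ 4 → ‖fderiv ℝ f z‖ ≤ C * |f z|

/-- `h` is harmonic in the disk of radius `R` outside of the closed unit disks around separated
points `c j`, and does not change sign around each of these disks. -/
structure PuncturedHarmonic {ι : Type} (c : ι → ℂ) (R : ℝ) (h : ℂ → ℝ) : Prop where
  sep : Separated c
  lt_radius : 2000 < R
  harmonic : InnerProductSpace.HarmonicOnNhd h {z | ‖z‖ < R ∧ ∀ j, 1 < ‖z - c j‖}
  sign : ∀ j, (∀ z, ‖z‖ < R → 1 < ‖z - c j‖ → ‖z - c j‖ ≤ 5 → 0 ≤ h z) ∨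
    (∀ z, ‖z‖ < R → 1 < ‖z - c j‖ → ‖z - c j‖ ≤ 5 → h z ≤ 0)

namespace PuncturedHarmonic

variable {ι : Type} {c : ι → ℂ} {R : ℝ} {h : ℂ → ℝ} {C₀ : ℝ}

lemma annulus_subset (H : PuncturedHarmonic c R h) {j : ι} (hj : ‖c j‖ < R - 5) :
    annulus (c j) ⊆ {z | ‖z‖ < R ∧ ∀ j, 1 < ‖z - c j‖} := by
  rintro z ⟨h1, h2⟩
  refine ⟨?_, fun i => ?_⟩
  · linarith [norm_le_norm_sub_add z (c j)]
  · by_cases hij : i = j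
    · rwa [hij]
    · linarith [H.sep.le_norm_sub hij h2.le]

lemma harnack (H : PuncturedHarmonic c R h) (hC : HarnackConst C₀) {j : ι}
    (hj : ‖c j‖ < R - 5) :
    (∀ z w, 2 ≤ ‖z - c j‖ → ‖z - c j‖ ≤ 4 → 2 ≤ ‖w - c j‖ → ‖w - c j‖ ≤ 4 →
      |h w| ≤ C₀ * |h z|) ∧
    ∀ z, 2 ≤ ‖z - c j‖ → ‖z - c j‖ ≤ 4 → ‖fderiv ℝ h z‖ ≤ C₀ * |h z| := by
  have hs := H.annulus_subset hj
  refine hC.2 h (c j) (H.harmonic.mono hs) ((H.sign j).imp ?_ ?_)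
  all_goals exact fun hp z hz => hp z (hs hz).1 hz.1 hz.2.le

lemma abs_le_and_norm_fderiv_le (H : PuncturedHarmonic c R h) (hC : HarnackConst C₀) {z : ℂ}
    {B : ℝ} (hz : ‖z‖ < R - 20) (hz2 : ∀ j, 2 ≤ ‖z - c j‖)
    (hB : ∀ w, ‖w - z‖ ≤ 8 → (∀ j, 3 < ‖w - c j‖) → |h w| ≤ B) :
    |h z| ≤ C₀ * B ∧ ‖fderiv ℝ h z‖ ≤ 16 * C₀ ^ 2 * B := by
  have hC1 := hC.1
  by_cases hj : ∃ j, ‖z - c j‖ ≤ 4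
  · obtain ⟨j, hj⟩ := hj
    have hcj : ‖c j‖ < R - 5 := by
      have := norm_le_norm_sub_add (c j) z
      rw [norm_sub_rev] at this
      linarith
    obtain ⟨k1, k2⟩ := H.harnack hC hcj
    have e : ‖c j + 7 / 2 - c j‖ = 7 / 2 := by simp
    have hw := hB (c j + 7 / 2) ?_ ?_
    · have e1 : |h z| ≤ C₀ * B := by
        refine (k1 (c j + 7 / 2) z (by rw [e]; norm_num) (by rw [e]; norm_num) (hz2 j) hj).trans ?_
        gcongr
      have hB0 : 0 ≤ B := (abs_nonneg _).trans hw
      refine ⟨e1, (k2 z (hz2 j) hj).trans ?_⟩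
      nlinarith [mul_le_mul_of_nonneg_left e1 (by linarith : 0 ≤ C₀),
        mul_nonneg (sq_nonneg C₀) hB0]
    · refine (norm_sub_le_norm_sub_add_norm_sub _ (c j) _).trans ?_
      rw [e, norm_sub_rev]; linarith
    · intro i
      by_cases hij : i = j
      · rw [hij, e]; norm_num
      · linarith [H.sep.le_norm_sub hij e.le]
  · push Not at hj
    have hb : ∀ w ∈ closedBall z (1 / 2), ∀ j, 3 < ‖w - c j‖ := by
      intro w hw j
      rw [mem_closedBall_iff_norm, norm_sub_rev] at hw
      linarith [hj j, norm_sub_le_norm_sub_add_norm_sub z w (c j)]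
    have hb' : ∀ w ∈ closedBall z (1 / 2), |h w| ≤ B := fun w hw =>
      hB w (by rw [mem_closedBall_iff_norm] at hw; linarith) (hb w hw)
    have e0 := hb' z (mem_closedBall_self (by norm_num))
    have hB0 : 0 ≤ B := (abs_nonneg _).trans e0
    have e1 := norm_fderiv_le_of_abs_le (by norm_num) (H.harmonic.mono ?_) hb'
    · have hC2 : 1 ≤ C₀ ^ 2 := one_le_pow₀ hC1
      constructor <;> nlinarith
    · intro w hw
      refine ⟨?_, fun j => by linarith [hb w hw j]⟩
      rw [mem_closedBall_iff_norm] at hw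
      linarith [norm_le_norm_sub_add w z]

lemma lapC_eq_zero (H : PuncturedHarmonic c R h) {z : ℂ} (hz : ‖z‖ < R)
    (hz1 : ∀ j, 1 < ‖z - c j‖) : lapC h z = 0 := by
  have h1 := H.harmonic z ⟨hz, hz1⟩
  have h2 := h1.2.eq_of_nhds
  rw [InnerProductSpace.laplacian_eq_iteratedFDeriv_complexPlane] at h2
  simpa [lapC, pd_pd_eq _ _ h1.1, iteratedFDeriv_two_apply] using h2

/-- The finite set of the indices of the points `c j` in the disk of radius `R`. -/
def _root_.Separated.indices {c : ι → ℂ} (hc : Separated c) (R : ℝ) : Finset ι :=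
  (hc.finite R).toFinset

@[simp] lemma _root_.Separated.mem_indices (hc : Separated c) {j : ι} :
    j ∈ hc.indices R ↔ ‖c j‖ < R := by simp [Separated.indices]

/-- The function `h` multiplied by the cutoff. -/
def localized (H : PuncturedHarmonic c R h) (z : ℂ) : ℝ :=
  h z * fullCutoff c (H.sep.indices R) R z

lemma localized_eventuallyEq_zero (H : PuncturedHarmonic c R h) {z : ℂ}
    (hz : R / 2 < ‖z‖ ∨ ∃ j, ‖z - c j‖ < 2) : H.localized =ᶠ[𝓝 z] 0 := by
  have hR := H.lt_radius
  by_cases hzR : R / 2 < ‖z‖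
  · filter_upwards [continuous_norm.continuousAt.eventually (lt_mem_nhds hzR)] with w hw
    rw [localized, fullCutoff, outerBump_eq_zero (by linarith) hw.le]; simp
  · obtain ⟨j, hj⟩ := hz.resolve_left hzR
    have hjm : j ∈ H.sep.indices R := by
      rw [H.sep.mem_indices]
      have := norm_le_norm_sub_add (c j) z
      rw [norm_sub_rev] at this
      linarith
    have hc : Continuous fun w : ℂ => ‖w - c j‖ := by fun_prop
    filter_upwards [diskCutoff_eventuallyEq H.sep hjm (hj.le.trans (by norm_num)),
      hc.continuousAt.eventually (gt_mem_nhds hj)] with w hw hw2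
    simp [localized, fullCutoff, hw, diskBump_eq_one hw2.le]

lemma localized_eventuallyEq (H : PuncturedHarmonic c R h) {z : ℂ}
    (hz : ‖z‖ < R / 4) (hz2 : ∀ j, 5 / 2 < ‖z - c j‖) : H.localized =ᶠ[𝓝 z] h := by
  have hR := H.lt_radius
  filter_upwards [diskCutoff_eventuallyEq_one (J := H.sep.indices R) fun j _ => hz2 j,
      continuous_norm.continuousAt.eventually (gt_mem_nhds hz)] with w hw hw2
  rw [localized, fullCutoff, hw, outerBump_eq_one (by linarith) hw2.le]; simp

lemma contDiffAt (H : PuncturedHarmonic c R h) {z : ℂ} (hz : ‖z‖ < R)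
    (hz1 : ∀ j, 1 < ‖z - c j‖) : ContDiffAt ℝ 2 h z := (H.harmonic z ⟨hz, hz1⟩).1

end PuncturedHarmonic

lemma abs_lapC_mul_abs_le {h Ψ : ℂ → ℝ} {z : ℂ} {A b K : ℝ} (hK : 0 ≤ K)
    (hh : ContDiffAt ℝ 2 h z) (hl : lapC h z = 0) (hΨ : C2Bound Ψ z A) (hb : |h z| ≤ b)
    (hd : ‖fderiv ℝ h z‖ ≤ b) :
    |lapC (fun w => h w * Ψ w) z| * |pd 1 (fun w => h w * Ψ w) z + K * (h z * Ψ z)|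
      ≤ 5 * (2 + K) * A ^ 2 * b ^ 2 := by
  obtain ⟨p1, p2, p3, p4, p5⟩ := hΨ
  have hA : 0 ≤ A := (abs_nonneg _).trans p2
  have hb0 : 0 ≤ b := (abs_nonneg _).trans hb
  have hp : ∀ v : ℂ, ‖v‖ = 1 → |pd v h z| ≤ b := fun v hv => by
    simpa [hv, pd] using (ContinuousLinearMap.le_of_opNorm_le _ hd v)
  have q1 := hp 1 (by simp)
  have q2 := hp Complex.I (by simp)
  rw [lapC_mul hh p1, hl, pd_mul 1 (hh.differentiableAt (by simp)) (p1.differentiableAt (by simp))]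
  have e1 := abs_le.1 (abs_mul_le_of_le hb p5)
  have e2 := abs_le.1 (abs_mul_le_of_le q1 p3)
  have e3 := abs_le.1 (abs_mul_le_of_le q2 p4)
  have e4 := abs_le.1 (abs_mul_le_of_le hb p3)
  have e5 := abs_le.1 (abs_mul_le_of_le q1 p2)
  have e6 := abs_le.1 (abs_mul_le_of_le (abs_of_nonneg hK).le (abs_mul_le_of_le hb p2))
  calc _ ≤ (5 * (b * A)) * ((2 + K) * (b * A)) := by
        gcongr
        · rw [abs_le]; constructor <;> linarith
        · rw [abs_le]; constructor <;> linarith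
    _ = _ := by ring

/-- `A` is an admissible bound for the cutoff functions. -/
def CutoffConst (A : ℝ) : Prop :=
  1 ≤ A ∧ ∀ (ι : Type) (c : ι → ℂ) (J : Finset ι) (R : ℝ) (z : ℂ),
    Separated c → 1 ≤ R → C2Bound (fullCutoff c J R) z A

namespace PuncturedHarmonic

variable {ι : Type} {c : ι → ℂ} {R : ℝ} {h : ℂ → ℝ} {C₀ A K M : ℝ}

lemma contDiff_localized (H : PuncturedHarmonic c R h) (hA : CutoffConst A) :
    ContDiff ℝ 2 H.localized := by
  rw [contDiff_iff_contDiffAt]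
  intro z
  have hR := H.lt_radius
  by_cases hz : R / 2 < ‖z‖ ∨ ∃ j, ‖z - c j‖ < 2
  · exact contDiffAt_const.congr_of_eventuallyEq (H.localized_eventuallyEq_zero hz)
  · push Not at hz
    exact (H.contDiffAt (by linarith) fun j => by linarith [hz.2 j]).mul
      (hA.2 ι c _ R z H.sep (by linarith)).1

lemma localized_eq_zero (H : PuncturedHarmonic c R h) {z : ℂ} (hz : R / 2 < ‖z‖) :
    H.localized z = 0 := (H.localized_eventuallyEq_zero (Or.inl hz)).eq_of_nhds

lemma hasCompactSupport_localized (H : PuncturedHarmonic c R h) :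
    HasCompactSupport H.localized :=
  HasCompactSupport.intro (isCompact_closedBall 0 (R / 2)) fun z hz =>
    H.localized_eq_zero (by simpa using hz)

/-- The integrand on the right-hand side of the Carleman inequality. -/
def density (H : PuncturedHarmonic c R h) (K : ℝ) (z : ℂ) : ℝ :=
  |lapC H.localized z| * |pd 1 H.localized z + K * H.localized z| * expWeight K z ^ 2

lemma density_eq_zero (H : PuncturedHarmonic c R h) {z : ℂ} (hz : lapC H.localized z = 0) :
    H.density K z = 0 := by simp [density, hz]

lemma density_eq_zero_of_eventuallyEq (H : PuncturedHarmonic c R h) {z : ℂ}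
    (hz : R / 2 < ‖z‖ ∨ ∃ j, ‖z - c j‖ < 2) : H.density K z = 0 := by
  refine H.density_eq_zero ?_
  rw [lapC_congr (H.localized_eventuallyEq_zero hz)]
  have h0 : ∀ v : ℂ, pd v (0 : ℂ → ℝ) = 0 := by intro v; ext w; simp [pd]
  simp [lapC, h0]

lemma expWeight_sq_le (hK : 0 ≤ K) {z : ℂ} {a : ℝ} (hz : z.re ≤ a) :
    expWeight K z ^ 2 ≤ Real.exp (2 * K * a) := by
  rw [expWeight, ← Real.exp_nat_mul, Real.exp_le_exp]
  push_cast
  nlinarith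

lemma le_expWeight_sq (hK : 0 ≤ K) {z : ℂ} {a : ℝ} (hz : a ≤ z.re) :
    Real.exp (2 * K * a) ≤ expWeight K z ^ 2 := by
  rw [expWeight, ← Real.exp_nat_mul, Real.exp_le_exp]
  push_cast
  nlinarith

lemma density_le (H : PuncturedHarmonic c R h) (hA : CutoffConst A) (hK : 0 ≤ K) {z : ℂ}
    {a b : ℝ} (hz : ‖z‖ < R) (hz1 : ∀ j, 1 < ‖z - c j‖) (hb : |h z| ≤ b)
    (hd : ‖fderiv ℝ h z‖ ≤ b) (hza : z.re ≤ a) :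
    H.density K z ≤ 5 * (2 + K) * A ^ 2 * b ^ 2 * Real.exp (2 * K * a) := by
  have hR := H.lt_radius
  refine mul_le_mul (abs_lapC_mul_abs_le hK (H.contDiffAt hz hz1) (H.lapC_eq_zero hz hz1)
    (hA.2 ι c _ R z H.sep (by linarith)) hb hd) (expWeight_sq_le hK hza) (by positivity)
    (by positivity)

/-- The indices of the disks well inside of the disk of radius `R / 4`. -/
def goodIndices (H : PuncturedHarmonic c R h) : Finset ι := H.sep.indices (R / 4 - 10)

lemma density_le_sum (H : PuncturedHarmonic c R h) (hC : HarnackConst C₀) (hA : CutoffConst A)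
    (hK : 0 ≤ K) (hM : ∀ z, R / 8 < ‖z‖ → ‖z‖ < R → (∀ j, 3 < ‖z - c j‖) → |h z| ≤ M) (z : ℂ) :
    H.density K z ≤ (∑ j ∈ H.goodIndices, (closedBall (c j) (5 / 2)).indicator
        (fun _ => 5 * (2 + K) * A ^ 2 * (C₀ ^ 2 * |h (c j + 7 / 2)|) ^ 2
          * Real.exp (2 * K * ((c j).re + 5 / 2))) z)
      + (closedBall 0 R).indicator (fun _ => 5 * (2 + K) * A ^ 2 * (16 * C₀ ^ 2 * M) ^ 2
          * Real.exp (2 * K * R)) z := by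
  have hR := H.lt_radius
  have hC1 := hC.1
  have n1 : ∀ j ∈ H.goodIndices, 0 ≤ (closedBall (c j) (5 / 2)).indicator
        (fun _ => 5 * (2 + K) * A ^ 2 * (C₀ ^ 2 * |h (c j + 7 / 2)|) ^ 2
          * Real.exp (2 * K * ((c j).re + 5 / 2))) z := fun j _ =>
    indicator_nonneg (fun _ _ => by positivity) _
  have n2 : 0 ≤ (closedBall 0 R).indicator (fun _ => 5 * (2 + K) * A ^ 2 * (16 * C₀ ^ 2 * M) ^ 2
          * Real.exp (2 * K * R)) z := indicator_nonneg (fun _ _ => by positivity) _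
  have n3 := Finset.sum_nonneg n1
  by_cases hz : R / 2 < ‖z‖ ∨ ∃ j, ‖z - c j‖ < 2
  · rw [H.density_eq_zero_of_eventuallyEq hz]; positivity
  push Not at hz
  obtain ⟨hzR, hz2⟩ := hz
  have hz1 : ∀ j, 1 < ‖z - c j‖ := fun j => by linarith [hz2 j]
  by_cases hzs : ‖z‖ < R / 4 - 13
  · by_cases hj : ∃ j, ‖z - c j‖ ≤ 5 / 2
    · obtain ⟨j, hj⟩ := hj
      have hcz := norm_le_norm_sub_add (c j) z
      rw [norm_sub_rev] at hcz
      have hjG : j ∈ H.goodIndices := by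
        rw [goodIndices, H.sep.mem_indices]; linarith
      have e : ‖c j + 7 / 2 - c j‖ = 7 / 2 := by simp
      obtain ⟨k1, k2⟩ := H.harnack hC (j := j) (by linarith)
      have e1 := k1 (c j + 7 / 2) z (by rw [e]; norm_num) (by rw [e]; norm_num) (hz2 j)
        (by linarith)
      have e2 := k2 z (hz2 j) (by linarith)
      have e3 : C₀ * |h z| ≤ C₀ ^ 2 * |h (c j + 7 / 2)| := by
        rw [pow_two, mul_assoc]; gcongr
      have hre : z.re ≤ (c j).re + 5 / 2 := by
        have := (Complex.re_le_norm (z - c j)).trans hj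
        rw [Complex.sub_re] at this; linarith
      have := H.density_le hA hK (by linarith) hz1
        ((le_mul_of_one_le_left (abs_nonneg _) hC1).trans e3) (e2.trans e3) hre
      have hs := Finset.single_le_sum n1 hjG
      rw [indicator_of_mem (by rwa [mem_closedBall_iff_norm])] at hs
      linarith
    · push Not at hj
      rw [H.density_eq_zero]
      · positivity
      · rw [lapC_congr (H.localized_eventuallyEq (by linarith) hj)]
        exact H.lapC_eq_zero (by linarith) hz1
  · obtain ⟨e1, e2⟩ := H.abs_le_and_norm_fderiv_le hC (B := M) (z := z) (by linarith) hz2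
      fun w hw hw3 => by
        have e1 := norm_le_norm_sub_add w z
        have e2 := norm_le_norm_sub_add z w
        rw [norm_sub_rev] at e2
        exact hM w (by linarith) (by linarith) hw3
    have hM0 : 0 ≤ M := by
      have : 0 ≤ C₀ * M := (abs_nonneg _).trans e1
      exact nonneg_of_mul_nonneg_right this (by linarith)
    have e3 : C₀ * M ≤ 16 * C₀ ^ 2 * M := by
      gcongr; nlinarith
    have := H.density_le hA hK (by linarith) hz1 (e1.trans e3) e2
      (a := R) ((Complex.re_le_norm z).trans (by linarith))
    rw [indicator_of_mem (by rw [mem_closedBall_zero_iff]; linarith)]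
    linarith

lemma le_sq_of_mem_ball (H : PuncturedHarmonic c R h) (hC : HarnackConst C₀) (hK : C₀ ≤ K)
    {j : ι} (hj : j ∈ H.goodIndices) {z : ℂ} (hz : z ∈ ball (c j + 13 / 4) (1 / 4)) :
    ((K - C₀) / C₀) ^ 2 * |h (c j + 7 / 2)| ^ 2 * Real.exp (2 * K * ((c j).re + 5 / 2))
      ≤ (expWeight K z * (pd 1 H.localized z + K * H.localized z)) ^ 2 := by
  have hR := H.lt_radius
  have hC1 := hC.1
  rw [goodIndices, H.sep.mem_indices] at hj
  rw [mem_ball_iff_norm] at hz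
  have e : ‖c j + 13 / 4 - c j‖ = 13 / 4 := by simp
  have e' : ‖c j + 7 / 2 - c j‖ = 7 / 2 := by simp
  have b1 : ‖z - c j‖ ≤ 7 / 2 := by
    linarith [norm_sub_le_norm_sub_add_norm_sub z (c j + 13 / 4) (c j)]
  have b2 : 3 ≤ ‖z - c j‖ := by
    have := norm_sub_le_norm_sub_add_norm_sub (c j + 13 / 4) z (c j)
    rw [norm_sub_rev (c j + 13 / 4) z] at this
    linarith
  have hre : (c j).re + 5 / 2 ≤ z.re := by
    have := (neg_le_abs _).trans ((Complex.abs_re_le_norm _).trans hz.le)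
    have e3 : (13 / 4 : ℂ).re = 13 / 4 := by norm_num
    rw [Complex.sub_re, Complex.add_re, e3] at this
    linarith
  have hnz : ‖z‖ < R / 4 := by linarith [norm_le_norm_sub_add z (c j)]
  have hloc : H.localized =ᶠ[𝓝 z] h := by
    refine H.localized_eventuallyEq hnz fun i => ?_
    by_cases hij : i = j
    · rw [hij]; linarith
    · linarith [H.sep.le_norm_sub hij b1]
  obtain ⟨k1, k2⟩ := H.harnack hC (j := j) (by linarith)
  have q1 := k1 z (c j + 7 / 2) (by linarith) (by linarith) (by rw [e']; norm_num)
    (by rw [e']; norm_num)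
  have q2 : |pd 1 h z| ≤ C₀ * |h z| := by
    simpa [pd] using ContinuousLinearMap.le_of_opNorm_le _ (k2 z (by linarith) (by linarith)) 1
  rw [(pd_eventuallyEq 1 hloc).eq_of_nhds, hloc.eq_of_nhds, mul_pow, mul_comm (expWeight K z ^ 2)]
  refine mul_le_mul ?_ (le_expWeight_sq (by linarith) hre) (by positivity) (by positivity)
  · rw [← mul_pow, ← sq_abs (pd 1 h z + K * h z)]
    refine pow_le_pow_left₀ (mul_nonneg (div_nonneg (by linarith) (by linarith))
      (abs_nonneg _)) ?_ 2
    calc (K - C₀) / C₀ * |h (c j + 7 / 2)| ≤ (K - C₀) / C₀ * (C₀ * |h z|) := by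
          have : 0 ≤ (K - C₀) / C₀ := div_nonneg (by linarith) (by linarith)
          gcongr
      _ = K * |h z| - C₀ * |h z| := by field_simp
      _ ≤ |K * h z| - |pd 1 h z| := by
          rw [abs_mul, abs_of_nonneg (by linarith : 0 ≤ K)]; linarith
      _ ≤ _ := by
          have := abs_sub_abs_le_abs_sub (K * h z) (-pd 1 h z)
          rwa [abs_neg, sub_neg_eq_add, add_comm (K * h z)] at this

end PuncturedHarmonic

lemma volume_real_ball (a : ℂ) {r : ℝ} (hr : 0 ≤ r) :
    (volume : Measure ℂ).real (ball a r) = Real.pi * r ^ 2 := by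
  simp [Measure.real, Complex.volume_ball, ENNReal.toReal_ofReal hr, mul_comm]

lemma volume_real_closedBall (a : ℂ) {r : ℝ} (hr : 0 ≤ r) :
    (volume : Measure ℂ).real (closedBall a r) = Real.pi * r ^ 2 := by
  simp [Measure.real, Complex.volume_closedBall, ENNReal.toReal_ofReal hr, mul_comm]

lemma integral_le_of_le_sum_indicator {ι : Type} {G : Finset ι} {p : ι → ℂ} {a : ι → ℝ}
    {r R b : ℝ} (hr : 0 ≤ r) (hR : 0 ≤ R) {F : ℂ → ℝ} (hF : Integrable F)
    (h : ∀ z, F z ≤ (∑ j ∈ G, (closedBall (p j) r).indicator (fun _ => a j) z)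
      + (closedBall 0 R).indicator (fun _ => b) z) :
    ∫ z, F z ≤ Real.pi * r ^ 2 * ∑ j ∈ G, a j + Real.pi * R ^ 2 * b := by
  have i1 : ∀ (x : ℂ) (s y : ℝ), Integrable ((closedBall x s).indicator fun _ => y) :=
    fun x s y => (integrable_indicator_iff measurableSet_closedBall).2
      (integrableOn_const measure_closedBall_lt_top.ne)
  have i2 : Integrable fun z => ∑ j ∈ G, (closedBall (p j) r).indicator (fun _ => a j) z :=
    integrable_finsetSum _ fun j _ => i1 _ _ _
  refine (integral_mono hF (i2.add (i1 0 R b)) h).trans (le_of_eq ?_)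
  simp only [Pi.add_apply]
  rw [integral_add i2 (i1 _ _ _), integral_finsetSum _ fun j _ => i1 _ _ _, Finset.mul_sum]
  simp only [integral_indicator_const _ measurableSet_closedBall, smul_eq_mul,
    volume_real_closedBall _ hr, volume_real_closedBall _ hR]

lemma sum_le_integral_of_le {ι : Type} {G : Finset ι} {p : ι → ℂ} {a : ι → ℝ} {r : ℝ}
    (hr : 0 ≤ r) (hp : (G : Set ι).Pairwise fun i j => Disjoint (ball (p i) r) (ball (p j) r))
    {f : ℂ → ℝ} (hf : Integrable f) (hf0 : ∀ z, 0 ≤ f z)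
    (h : ∀ j ∈ G, ∀ z ∈ ball (p j) r, a j ≤ f z) :
    Real.pi * r ^ 2 * ∑ j ∈ G, a j ≤ ∫ z, f z := by
  calc Real.pi * r ^ 2 * ∑ j ∈ G, a j = ∑ j ∈ G, ∫ _ in ball (p j) r, a j := by
        simp [Finset.mul_sum, volume_real_ball _ hr]
    _ ≤ ∑ j ∈ G, ∫ z in ball (p j) r, f z := Finset.sum_le_sum fun j hj =>
        setIntegral_mono_on (integrableOn_const (by finiteness)) hf.integrableOn
          measurableSet_ball (h j hj)
    _ = ∫ z in ⋃ j ∈ G, ball (p j) r, f z :=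
        (integral_biUnion_finset G (fun _ _ => measurableSet_ball) hp
          fun _ _ => hf.integrableOn).symm
    _ ≤ ∫ z, f z := setIntegral_le_integral hf (ae_of_all _ hf0)

namespace PuncturedHarmonic

variable {ι : Type} {c : ι → ℂ} {R : ℝ} {h : ℂ → ℝ} {C₀ A K M : ℝ}

lemma integrable_sq (H : PuncturedHarmonic c R h) (hA : CutoffConst A) (K : ℝ) :
    Integrable fun z => (expWeight K z * (pd 1 H.localized z + K * H.localized z)) ^ 2 := by
  have hu := H.contDiff_localized hA
  have hus := H.hasCompactSupport_localized
  have hx : Continuous (pd 1 H.localized) := (contDiff_pd (n := 1) 1 hu).continuous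
  have hw : Continuous (expWeight K) := (contDiff_expWeight K (n := 0)).continuous
  have hs : HasCompactSupport fun z => expWeight K z * (pd 1 H.localized z + K * H.localized z) :=
    ((hus.pd 1).add (hus.mul_left (f := fun _ => K))).mul_left
  simp only [pow_two]
  exact ((hw.mul (hx.add (continuous_const.mul hu.continuous))).mul
    (hw.mul (hx.add (continuous_const.mul hu.continuous)))).integrable_of_hasCompactSupport
    hs.mul_left

lemma sum_le_integral_sq (H : PuncturedHarmonic c R h) (hC : HarnackConst C₀)
    (hA : CutoffConst A) (hK : C₀ ≤ K) :
    Real.pi * (1 / 4) ^ 2 * ∑ j ∈ H.goodIndices, ((K - C₀) / C₀) ^ 2 * |h (c j + 7 / 2)| ^ 2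
        * Real.exp (2 * K * ((c j).re + 5 / 2))
      ≤ ∫ z, (expWeight K z * (pd 1 H.localized z + K * H.localized z)) ^ 2 := by
  refine sum_le_integral_of_le (p := fun j => c j + 13 / 4) (by norm_num) ?_ (H.integrable_sq hA K)
    (fun _ => sq_nonneg _) fun j hj z hz => H.le_sq_of_mem_ball hC hK hj hz
  intro i _ j _ hij
  refine ball_disjoint_ball ?_
  rw [dist_add_right, dist_eq_norm]
  linarith [H.sep i j hij]

lemma integral_sq_le (H : PuncturedHarmonic c R h) (hC : HarnackConst C₀) (hA : CutoffConst A)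
    (hM : ∀ z, R / 8 < ‖z‖ → ‖z‖ < R → (∀ j, 3 < ‖z - c j‖) → |h z| ≤ M)
    (hK : K = 100 * A * C₀ ^ 3) :
    ∫ z, (expWeight K z * (pd 1 H.localized z + K * H.localized z)) ^ 2
      ≤ Real.pi * R ^ 2 *
        (5 * (2 + K) * A ^ 2 * (16 * C₀ ^ 2 * M) ^ 2 * Real.exp (2 * K * R)) := by
  have hR := H.lt_radius
  have hC1 := hC.1
  have hA1 := hA.1
  have hC3 : C₀ ≤ C₀ ^ 3 := le_self_pow₀ hC1 (by norm_num)
  have hAC : C₀ ^ 3 ≤ A * C₀ ^ 3 := le_mul_of_one_le_left (by positivity) hA1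
  have hKC : 100 * C₀ ≤ K := by rw [hK]; linarith
  have hK0 : 0 ≤ K := by linarith
  have e1 := carleman_inequality K (H.contDiff_localized hA) H.hasCompactSupport_localized
  have e2 := integral_le_of_le_sum_indicator (by norm_num) (by linarith)
    (lapC_abs_integrand_integrable K (H.contDiff_localized hA) H.hasCompactSupport_localized)
    (H.density_le_sum hC hA hK0 hM)
  have e3 := H.sum_le_integral_sq hC hA (K := K) (by linarith)
  set X := ∫ z, (expWeight K z * (pd 1 H.localized z + K * H.localized z)) ^ 2
  set S := ∑ j ∈ H.goodIndices, |h (c j + 7 / 2)| ^ 2 * Real.exp (2 * K * ((c j).re + 5 / 2))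
    with hS
  set T := Real.pi * R ^ 2 *
        (5 * (2 + K) * A ^ 2 * (16 * C₀ ^ 2 * M) ^ 2 * Real.exp (2 * K * R))
  have hS0 : 0 ≤ S := Finset.sum_nonneg fun _ _ => by positivity
  have hT0 : 0 ≤ T := by positivity
  have s1 : ∑ j ∈ H.goodIndices, 5 * (2 + K) * A ^ 2 * (C₀ ^ 2 * |h (c j + 7 / 2)|) ^ 2
      * Real.exp (2 * K * ((c j).re + 5 / 2)) = 5 * (2 + K) * A ^ 2 * C₀ ^ 4 * S := by
    rw [hS, Finset.mul_sum]
    exact Finset.sum_congr rfl fun j _ => by ring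
  have s2 : ∑ j ∈ H.goodIndices, ((K - C₀) / C₀) ^ 2 * |h (c j + 7 / 2)| ^ 2
      * Real.exp (2 * K * ((c j).re + 5 / 2)) = ((K - C₀) / C₀) ^ 2 * S := by
    rw [hS, Finset.mul_sum]
    exact Finset.sum_congr rfl fun j _ => by ring
  rw [s1] at e2
  rw [s2] at e3
  have hκ : (50 * A * C₀ ^ 2) ^ 2 ≤ ((K - C₀) / C₀) ^ 2 := by
    refine pow_le_pow_left₀ (by positivity) ?_ 2
    rw [le_div_iff₀ (by linarith), hK]
    nlinarith
  have hα : 100 * (5 * (2 + K) * A ^ 2 * C₀ ^ 4) ≤ K * ((K - C₀) / C₀) ^ 2 := by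
    calc 100 * (5 * (2 + K) * A ^ 2 * C₀ ^ 4) ≤ 100 * (5 * (5 * K) * A ^ 2 * C₀ ^ 4) := by
          gcongr; linarith
      _ = K * (50 * A * C₀ ^ 2) ^ 2 := by ring
      _ ≤ _ := by gcongr
  have hfin : Real.pi * (5 / 2) ^ 2 * (5 * (2 + K) * A ^ 2 * C₀ ^ 4 * S) ≤ K * X := by
    have e4 := mul_le_mul_of_nonneg_left e3 hK0
    have e5 := mul_le_mul_of_nonneg_left hα
      (mul_nonneg Real.pi_pos.le hS0)
    linarith
  have hX0 : 0 ≤ X := integral_nonneg fun _ => sq_nonneg _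
  have hKX : K * X ≤ T := by linarith
  nlinarith

lemma integral_weighted_sq_le (H : PuncturedHarmonic c R h) (hA : CutoffConst A) (K : ℝ) :
    ∫ z, (expWeight K z * H.localized z) ^ 2
      ≤ R ^ 2 * ∫ z, (expWeight K z * (pd 1 H.localized z + K * H.localized z)) ^ 2 := by
  have hu := H.contDiff_localized hA
  have := integral_sq_le_of_support (v := fun z => expWeight K z * H.localized z) (ρ := R / 2)
    ((contDiff_expWeight K (n := 1)).mul (hu.of_le (by norm_num)))
    H.hasCompactSupport_localized.mul_left fun z hz => by
      simp only [H.localized_eq_zero hz, mul_zero]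
  simp only [fun z => pd_one_expWeight_mul K (hu.contDiffAt.differentiableAt (x := z) (by simp))]
    at this
  refine this.trans (le_of_eq ?_)
  ring

end PuncturedHarmonic

namespace PuncturedHarmonic

variable {ι : Type} {c : ι → ℂ} {R : ℝ} {h : ℂ → ℝ} {C₀ A K M : ℝ}

lemma exists_isMaxOn (H : PuncturedHarmonic c R h) {z : ℂ} (hz : ‖z‖ ≤ R / 8)
    (hz3 : ∀ j, 3 ≤ ‖z - c j‖) : ∃ z₀, ‖z₀‖ ≤ R / 8 ∧ (∀ j, 3 ≤ ‖z₀ - c j‖) ∧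
      ∀ w, ‖w‖ ≤ R / 8 → (∀ j, 3 ≤ ‖w - c j‖) → |h w| ≤ |h z₀| := by
  have hR := H.lt_radius
  have hcl : IsClosed {z : ℂ | ∀ j, 3 ≤ ‖z - c j‖} := by
    simp only [ofPred_forall]
    exact isClosed_iInter fun j => isClosed_le (by fun_prop) (by fun_prop)
  have hcomp := (isCompact_closedBall (0 : ℂ) (R / 8)).inter_right hcl
  obtain ⟨z₀, ⟨h1, h2⟩, hmax⟩ := hcomp.exists_isMaxOn (f := fun z => |h z|)
    ⟨z, by simpa using hz, hz3⟩ fun w hw => by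
      have hw1 : ‖w‖ ≤ R / 8 := by simpa using hw.1
      exact (H.contDiffAt (by linarith) fun j => by
        linarith [hw.2 j]).continuousAt.abs.continuousWithinAt
  exact ⟨z₀, by simpa using h1, h2, fun w hw1 hw2 => hmax ⟨by simpa using hw1, hw2⟩⟩

lemma half_le_abs (H : PuncturedHarmonic c R h) (hC : HarnackConst C₀) {z₀ w : ℂ}
    (hz : ‖z₀‖ ≤ R / 8) (hz3 : ∀ j, 3 ≤ ‖z₀ - c j‖)
    (hmax : ∀ w, ‖w‖ < R → (∀ j, 3 < ‖w - c j‖) → |h w| ≤ |h z₀|)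
    (hw : ‖w - z₀‖ ≤ 1 / (32 * C₀ ^ 2)) : |h z₀| / 2 ≤ |h w| := by
  have hR := H.lt_radius
  have hC0 : C₀ ≠ 0 := (zero_lt_one.trans_le hC.1).ne'
  have hC1 : 1 ≤ C₀ ^ 2 := one_le_pow₀ hC.1
  have hb : ∀ x ∈ ball z₀ (1 / 4), ‖x‖ < R / 8 + 1 / 4 ∧ ∀ j, 2 < ‖x - c j‖ := by
    intro x hx
    rw [mem_ball_iff_norm] at hx
    refine ⟨by linarith [norm_le_norm_sub_add x z₀], fun j => ?_⟩
    have := norm_sub_le_norm_sub_add_norm_sub z₀ x (c j)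
    rw [norm_sub_rev z₀ x] at this
    linarith [hz3 j]
  have hd : ∀ x ∈ ball z₀ (1 / 4), ‖fderiv ℝ h x‖ ≤ 16 * C₀ ^ 2 * |h z₀| := by
    intro x hx
    obtain ⟨b1, b2⟩ := hb x hx
    refine (H.abs_le_and_norm_fderiv_le hC (by linarith) (fun j => (b2 j).le)
      fun y hy hy3 => hmax y ?_ hy3).2
    linarith [norm_le_norm_sub_add y x]
  have hδ : 1 / (32 * C₀ ^ 2) < 1 / 4 := by
    rw [div_lt_div_iff₀ (by positivity) (by norm_num)]; linarith
  have := (convex_ball z₀ (1 / 4)).norm_image_sub_le_of_norm_fderiv_le (fun x hx =>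
    (H.contDiffAt (by linarith [(hb x hx).1]) fun j => by
      linarith [(hb x hx).2 j]).differentiableAt (by simp)) hd
    (mem_ball_self (by norm_num)) (mem_ball_iff_norm.2 (hw.trans_lt hδ))
  have h2 : 16 * C₀ ^ 2 * |h z₀| * ‖w - z₀‖ ≤ |h z₀| / 2 := by
    calc _ ≤ 16 * C₀ ^ 2 * |h z₀| * (1 / (32 * C₀ ^ 2)) := by gcongr
      _ = _ := by field_simp; ring
  have h3 := abs_sub_abs_le_abs_sub (h z₀) (h w)
  rw [abs_sub_comm, ← Real.norm_eq_abs (h w - h z₀)] at h3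
  linarith

lemma mul_sq_le_integral (H : PuncturedHarmonic c R h) (hC : HarnackConst C₀)
    (hA : CutoffConst A) (hK : 0 ≤ K) {z₀ : ℂ} (hz : ‖z₀‖ ≤ R / 8) (hz3 : ∀ j, 3 ≤ ‖z₀ - c j‖)
    (hmax : ∀ w, ‖w‖ < R → (∀ j, 3 < ‖w - c j‖) → |h w| ≤ |h z₀|) :
    Real.pi * (1 / (32 * C₀ ^ 2)) ^ 2 * ((|h z₀| / 2) ^ 2 * Real.exp (2 * K * (-R)))
      ≤ ∫ z, (expWeight K z * H.localized z) ^ 2 := by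
  have hR := H.lt_radius
  have hC1 : 1 ≤ C₀ ^ 2 := one_le_pow₀ hC.1
  have hu := H.contDiff_localized hA
  have hc : Continuous fun z => expWeight K z * H.localized z :=
    (contDiff_expWeight K (n := 0)).continuous.mul hu.continuous
  have hi : Integrable fun z => (expWeight K z * H.localized z) ^ 2 :=
    (hc.pow 2).integrable_of_hasCompactSupport (by
      simpa only [pow_two] using! H.hasCompactSupport_localized.mul_left.mul_left)
  have hδ : 1 / (32 * C₀ ^ 2) ≤ 1 / 32 := by
    rw [div_le_div_iff₀ (by positivity) (by norm_num)]; linarith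
  have := sum_le_integral_of_le (G := {()}) (p := fun _ => z₀) (r := 1 / (32 * C₀ ^ 2))
    (a := fun _ => (|h z₀| / 2) ^ 2 * Real.exp (2 * K * (-R))) (by positivity) (by simp) hi
    (fun _ => sq_nonneg _) fun _ _ w hw => ?_
  · simpa using this
  · rw [mem_ball_iff_norm] at hw
    have hw1 : ‖w‖ < R / 4 := by linarith [norm_le_norm_sub_add w z₀]
    have hloc := (H.localized_eventuallyEq hw1 fun j => by
      have := norm_sub_le_norm_sub_add_norm_sub z₀ w (c j)
      rw [norm_sub_rev z₀ w] at this
      linarith [hz3 j]).eq_of_nhds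
    rw [hloc, mul_pow, mul_comm (expWeight K w ^ 2), ← sq_abs (h w)]
    refine mul_le_mul (pow_le_pow_left₀ (by positivity)
      (H.half_le_abs hC hz hz3 hmax hw.le) 2) (le_expWeight_sq hK ?_) (by positivity)
      (by positivity)
    have := (neg_le_abs _).trans (Complex.abs_re_le_norm w)
    linarith

lemma abs_le_exp_mul (H : PuncturedHarmonic c R h) (hC : HarnackConst C₀) (hA : CutoffConst A)
    (hK : K = 100 * A * C₀ ^ 3) (hM0 : 0 ≤ M)
    (hM : ∀ z, R / 8 < ‖z‖ → ‖z‖ < R → (∀ j, 3 < ‖z - c j‖) → |h z| ≤ M) {z : ℂ}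
    (hz : ‖z‖ < R) (hz3 : ∀ j, 3 < ‖z - c j‖) :
    |h z| ≤ Real.exp ((4 * K + 4
      + 4 * (5 * (2 + K) * A ^ 2 * (16 * C₀ ^ 2) ^ 2) * (32 * C₀ ^ 2) ^ 2) * R) * M := by
  have hR := H.lt_radius
  have hC1 : 1 ≤ C₀ := hC.1
  have hA1 : 1 ≤ A := hA.1
  have hK0 : 0 ≤ K := by rw [hK]; positivity
  set T := 4 * (5 * (2 + K) * A ^ 2 * (16 * C₀ ^ 2) ^ 2) * (32 * C₀ ^ 2) ^ 2 with hT
  have hT0 : 0 ≤ T := by positivity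
  have hle : M ≤ Real.exp ((4 * K + 4 + T) * R) * M :=
    le_mul_of_one_le_left hM0 (Real.one_le_exp (by positivity))
  by_cases hz8 : R / 8 < ‖z‖
  · exact (hM z hz8 hz hz3).trans hle
  obtain ⟨z₀, h1, h2, h3⟩ := H.exists_isMaxOn (not_lt.1 hz8) fun j => (hz3 j).le
  refine (h3 z (not_lt.1 hz8) fun j => (hz3 j).le).trans ?_
  by_cases hzM : |h z₀| ≤ M
  · exact hzM.trans hle
  have hmax : ∀ w, ‖w‖ < R → (∀ j, 3 < ‖w - c j‖) → |h w| ≤ |h z₀| := fun w hw hw3 => by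
    by_cases hw8 : R / 8 < ‖w‖
    · exact (hM w hw8 hw hw3).trans (not_le.1 hzM).le
    · exact h3 w (not_lt.1 hw8) fun j => (hw3 j).le
  have e1 := (H.mul_sq_le_integral hC hA hK0 h1 h2 hmax).trans
    ((H.integral_weighted_sq_le hA K).trans
      (mul_le_mul_of_nonneg_left (H.integral_sq_le hC hA hM hK) (sq_nonneg R)))
  have e2 : |h z₀| ^ 2 ≤ T * R ^ 4 * Real.exp (4 * K * R) * M ^ 2 := by
    have e3 : Real.exp (2 * K * (-R)) * Real.exp (2 * K * R) = 1 := by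
      rw [← Real.exp_add, ← Real.exp_zero]; ring_nf
    have e4 : Real.exp (4 * K * R) = Real.exp (2 * K * R) * Real.exp (2 * K * R) := by
      rw [← Real.exp_add]; ring_nf
    have e5 := mul_le_mul_of_nonneg_left e1
      (by positivity : 0 ≤ 4 * (32 * C₀ ^ 2) ^ 2 * Real.pi⁻¹ * Real.exp (2 * K * R))
    have e6 : 4 * (32 * C₀ ^ 2) ^ 2 * Real.pi⁻¹ * Real.exp (2 * K * R) * (Real.pi *
        (1 / (32 * C₀ ^ 2)) ^ 2 * ((|h z₀| / 2) ^ 2 * Real.exp (2 * K * (-R))))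
        = |h z₀| ^ 2 * (Real.exp (2 * K * (-R)) * Real.exp (2 * K * R)) := by
      field_simp; norm_num
    rw [e6, e3, mul_one] at e5
    refine e5.trans (le_of_eq ?_)
    rw [e4, hT]
    field_simp
  refine (pow_le_pow_iff_left₀ (abs_nonneg _) (by positivity) two_ne_zero).1 (e2.trans ?_)
  have f1 : T ≤ Real.exp (T * R) := by
    refine (Real.add_one_le_exp (T * R)).trans' ?_
    nlinarith
  have f2 : R ^ 4 ≤ Real.exp (4 * R) := by
    have : Real.exp (4 * R) = Real.exp R ^ 4 := by rw [← Real.exp_nat_mul]; norm_num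
    rw [this]
    exact pow_le_pow_left₀ (by linarith) (by linarith [Real.add_one_le_exp R]) 4
  calc T * R ^ 4 * Real.exp (4 * K * R) * M ^ 2
      ≤ Real.exp (T * R) * Real.exp (4 * R) * Real.exp (4 * K * R) * M ^ 2 := by gcongr
    _ = Real.exp ((4 * K + 4 + T) * R) * M ^ 2 := by
        rw [← Real.exp_add, ← Real.exp_add]; ring_nf
    _ ≤ Real.exp ((4 * K + 4 + T) * R) ^ 2 * M ^ 2 := by
        gcongr
        exact le_self_pow₀ (Real.one_le_exp (by positivity)) two_ne_zero
    _ = _ := by ring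

end PuncturedHarmonic

/-- The exponential bound for harmonic functions in a punctured disk of the complex plane. -/
lemma exists_abs_le_exp_mul : ∃ C : ℝ, 0 < C ∧
    ∀ (ι : Type) (c : ι → ℂ) (R : ℝ) (h : ℂ → ℝ) (M : ℝ), PuncturedHarmonic c R h → 0 ≤ M →
      (∀ z, R / 8 < ‖z‖ → ‖z‖ < R → (∀ j, 3 < ‖z - c j‖) → |h z| ≤ M) →
      ∀ z, ‖z‖ < R → (∀ j, 3 < ‖z - c j‖) → |h z| ≤ Real.exp (C * R) * M := by
  obtain ⟨C₀, hC⟩ := exists_harnack_annulus_abs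
  obtain ⟨A, hA⟩ := exists_cutoff_bound
  have hC1 := hC.1
  have hA1 := hA.1
  exact ⟨_, by positivity, fun ι c R h M H hM0 hM z hz hz3 =>
    H.abs_le_exp_mul hC hA rfl hM0 hM hz hz3⟩

lemma Separated.isOpen {ι : Type} {c : ι → ℂ} (hc : Separated c) (R : ℝ) :
    IsOpen {z : ℂ | ‖z‖ < R ∧ ∀ j, 1 < ‖z - c j‖} := by
  rw [isOpen_iff_mem_nhds]
  rintro z ⟨hz, hz1⟩
  have hR := continuous_norm.continuousAt.eventually (gt_mem_nhds hz)
  by_cases hj : ∃ j, ‖z - c j‖ ≤ 5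
  · obtain ⟨j, hj⟩ := hj
    have hcj : Continuous fun w : ℂ => ‖w - c j‖ := by fun_prop
    filter_upwards [hR, hcj.continuousAt.eventually (lt_mem_nhds (hz1 j)),
      ball_mem_nhds z one_pos] with w hw1 hw2 hw3
    refine ⟨hw1, fun i => ?_⟩
    rw [mem_ball_iff_norm] at hw3
    by_cases hij : i = j
    · rwa [hij]
    · have := norm_sub_le_norm_sub_add_norm_sub w z (c j)
      linarith [hc.le_norm_sub hij (by linarith : ‖w - c j‖ ≤ 6)]
  · push Not at hj
    filter_upwards [hR, ball_mem_nhds z one_pos] with w hw1 hw2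
    refine ⟨hw1, fun j => ?_⟩
    rw [mem_ball_iff_norm, norm_sub_rev] at hw2
    linarith [hj j, norm_sub_le_norm_sub_add_norm_sub z w (c j)]

lemma harmonicOnNhd_of_lapC_eq_zero {f : ℂ → ℝ} {U : Set ℂ} (hU : IsOpen U)
    (hf : ∀ z ∈ U, ContDiffAt ℝ 2 f z ∧ lapC f z = 0) :
    InnerProductSpace.HarmonicOnNhd f U := by
  refine fun z hz => ⟨(hf z hz).1, ?_⟩
  filter_upwards [hU.mem_nhds hz] with w hw
  rw [InnerProductSpace.laplacian_eq_iteratedFDeriv_complexPlane]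
  simpa [lapC, pd_pd_eq _ _ (hf w hw).1, iteratedFDeriv_two_apply] using (hf w hw).2

/-- The standard isometry between the complex plane and the Euclidean plane. -/
def planeIsometry : ℂ ≃ₗᵢ[ℝ] E2 := Complex.orthonormalBasisOneI.repr

lemma planeIsometry_one : planeIsometry 1 = EuclideanSpace.single 0 1 := by
  ext i; fin_cases i <;> simp [planeIsometry]

lemma planeIsometry_I : planeIsometry Complex.I = EuclideanSpace.single 1 1 := by
  ext i; fin_cases i <;> simp [planeIsometry]

lemma pd_comp_planeIsometry (g : E2 → ℝ) (v : ℂ) :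
    pd v (fun z => g (planeIsometry z)) =
      fun z => fderiv ℝ g (planeIsometry z) (planeIsometry v) := by
  ext z
  have := planeIsometry.toContinuousLinearEquiv.comp_right_fderiv (f := g) (x := z)
  exact congrArg (fun L => L v) this

lemma lapC_comp_planeIsometry (g : E2 → ℝ) (z : ℂ) :
    lapC (fun z => g (planeIsometry z)) z = lap g (planeIsometry z) := by
  have h : ∀ v : ℂ, pd v (pd v fun z => g (planeIsometry z)) z =
      fderiv ℝ (fun y => fderiv ℝ g y (planeIsometry v)) (planeIsometry z) (planeIsometry v) := by
    intro v
    rw [pd_comp_planeIsometry, pd_comp_planeIsometry fun y => fderiv ℝ g y (planeIsometry v)]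
  simp only [lapC, lap, h, Fin.sum_univ_two, planeIsometry_one, planeIsometry_I]

lemma norm_sub_planeIsometry_symm (z : ℂ) (x : E2) :
    ‖z - planeIsometry.symm x‖ = dist (planeIsometry z) x := by
  rw [dist_eq_norm, ← planeIsometry.norm_map, map_sub, planeIsometry.apply_symm_apply]

lemma puncturedHarmonic_comp_planeIsometry {ι : Type} {c : ι → E2} {R : ℝ} {h : E2 → ℝ}
    (hc : UnitBallsSeparated c 1000) (hR : 2000 < R)
    (hh : HarmonicOnSet h (ball (0 : E2) R \ ⋃ i, closedBall (c i) 1))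
    (hs : ∀ i, NoSignChange h ((closedBall (c i) 5 \ closedBall (c i) 1) ∩ ball (0 : E2) R)) :
    PuncturedHarmonic (fun j => planeIsometry.symm (c j)) R fun z => h (planeIsometry z) := by
  have hn := fun z j => norm_sub_planeIsometry_symm z (c j)
  have hsep : Separated fun j => planeIsometry.symm (c j) := by
    intro i j hij
    rw [hn, planeIsometry.apply_symm_apply]
    exact hc i j hij _ (mem_closedBall_self zero_le_one) _ (mem_closedBall_self zero_le_one)
  refine ⟨hsep, hR, harmonicOnNhd_of_lapC_eq_zero (hsep.isOpen R) ?_, fun j => ?_⟩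
  · rintro z ⟨hz, hz1⟩
    rw [lapC_comp_planeIsometry]
    obtain ⟨h1, h2⟩ := hh (planeIsometry z) ⟨by simpa using hz, by simpa [hn] using hz1⟩
    exact ⟨h1.comp z planeIsometry.toContinuousLinearEquiv.contDiff.contDiffAt, h2⟩
  · refine (hs j).imp ?_ ?_
    all_goals
      intro hp z h1 h2 h3
      rw [hn] at h2 h3
      exact hp _ ⟨⟨h3, by simpa using h2⟩, by simpa using h1⟩

/-- **Theorem 3.** Exponential bound for harmonic functions in a disk punctured by
`1000`-separated unit disks, with no sign change in the surrounding annuli. -/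
theorem harmonic_punctured_disk :
    ∃ C : ℝ, 0 < C ∧
      ∀ (ι : Type) (c : ι → E2) (R' : ℝ) (h : E2 → ℝ),
        UnitBallsSeparated c 1000 → 2000 < R' →
        HarmonicOnSet h (ball (0 : E2) R' \ ⋃ i, closedBall (c i) 1) →
        (∀ i, NoSignChange h ((closedBall (c i) 5 \ closedBall (c i) 1) ∩ ball (0 : E2) R')) →
        supAbs h (ball (0 : E2) R' \ ⋃ i, closedBall (c i) 3) ≤
          Real.exp (C * R') *
            supAbs h ({z : E2 | R' / 8 < ‖z‖ ∧ ‖z‖ < R'} \ ⋃ i, closedBall (c i) 3) := by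
  obtain ⟨C, hC0, hC⟩ := exists_abs_le_exp_mul
  refine ⟨C, hC0, fun ι c R h hc hR hh hs => ?_⟩
  have H := puncturedHarmonic_comp_planeIsometry hc hR hh hs
  have hsub : {z : E2 | R / 8 < ‖z‖ ∧ ‖z‖ < R} \ ⋃ i, closedBall (c i) 3 ⊆
      ball (0 : E2) R \ ⋃ i, closedBall (c i) 3 :=
    sdiff_subset_sdiff_left fun z hz => by simpa using hz.2
  by_cases hb : BddAbove ((fun z => |h z|) ''
      ({z : E2 | R / 8 < ‖z‖ ∧ ‖z‖ < R} \ ⋃ i, closedBall (c i) 3))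
  · have hM0 : 0 ≤ supAbs h ({z : E2 | R / 8 < ‖z‖ ∧ ‖z‖ < R} \ ⋃ i, closedBall (c i) 3) :=
      Real.sSup_nonneg (by rintro _ ⟨z, -, rfl⟩; exact abs_nonneg _)
    have hn := fun z j => norm_sub_planeIsometry_symm z (c j)
    have key := hC ι _ R _ _ H hM0 fun z h1 h2 h3 =>
      le_csSup hb (mem_image_of_mem _ ⟨⟨by simpa using h1, by simpa using h2⟩,
        by simpa [hn] using h3⟩)
    refine Real.sSup_le ?_ (by positivity)
    rintro _ ⟨x, ⟨hx1, hx2⟩, rfl⟩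
    simpa using key (planeIsometry.symm x) (by simpa using hx1) (by simpa [hn] using hx2)
  · rw [supAbs, supAbs, Real.sSup_of_not_bddAbove hb,
      Real.sSup_of_not_bddAbove fun hb' => hb (hb'.mono (image_mono hsub)), mul_zero]
end
end

section
/- For every C > 1 there is a constant C̃ > 0, depending only on C, with the following property: let R > 1 and let F be a closed subset of B(0, R) ⊂ ℝ² such that (a) for every z₀ ∈ F and every r ∈ (0, 1], the circle {z : |z − z₀| = r} intersects F ∪ ∂B(0, R), and (b) every point of B(0, R) is at distance at most C from F ∪ ∂B(0, R). Then the open set Ω = B(0, R) ∖ F satisfies the Poincaré inequality ∫_Ω f² ≤ C̃ ∫_Ω |∇f|² for every f ∈ C₀^∞(Ω). -/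
noncomputable section

open MeasureTheory Metric Filter Set
open scoped Topology ENNReal RealInnerProductSpace

/-- The Cauchy–Schwarz inequality against the constant function `1`. -/
theorem sq_lintegral_le {α : Type*} [MeasurableSpace α] (μ : Measure α) {u : α → ℝ≥0∞}
    (hu : AEMeasurable u μ) : (∫⁻ x, u x ∂μ) ^ 2 ≤ μ univ * ∫⁻ x, u x ^ 2 ∂μ := by
  have h := ENNReal.lintegral_mul_le_Lp_mul_Lq μ (p := 2) (q := 2)
    Real.HolderConjugate.two_two (f := fun _ => 1) aemeasurable_const hu
  simp only [Pi.mul_apply, one_mul, one_pow, lintegral_const, ENNReal.rpow_two] at h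
  calc (∫⁻ x, u x ∂μ) ^ 2
      ≤ (μ univ ^ (1 / 2 : ℝ) * (∫⁻ x, u x ^ 2 ∂μ) ^ (1 / 2 : ℝ)) ^ 2 := by gcongr
    _ = μ univ * ∫⁻ x, u x ^ 2 ∂μ := by
      rw [mul_pow, ← ENNReal.rpow_two, ← ENNReal.rpow_two, ← ENNReal.rpow_mul, ← ENNReal.rpow_mul]
      norm_num

/-- On an interval, the oscillation of a `C¹` function is controlled by the energy. -/
theorem enorm_sub_sq_le_lintegral_deriv {φ : ℝ → ℝ} (hφ : ContDiff ℝ 1 φ) {a b s t : ℝ}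
    (hs : s ∈ Icc a b) (ht : t ∈ Icc a b) :
    ‖φ t - φ s‖ₑ ^ 2 ≤ ENNReal.ofReal (b - a) * ∫⁻ x in Icc a b, ‖deriv φ x‖ₑ ^ 2 := by
  wlog hst : s ≤ t generalizing s t
  · rw [← enorm_neg, neg_sub]
    exact this ht hs (le_of_not_ge hst)
  calc ‖φ t - φ s‖ₑ ^ 2 ≤ (∫⁻ x in Icc a b, ‖deriv φ x‖ₑ) ^ 2 := by
        gcongr
        exact (enorm_sub_le_lintegral_deriv_of_contDiffOn_Icc hφ.contDiffOn hst).trans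
          (lintegral_mono_set (Icc_subset_Icc hs.1 ht.2))
    _ ≤ _ := by
        have h := sq_lintegral_le (volume.restrict (Icc a b)) (u := fun x => ‖deriv φ x‖ₑ)
          (hφ.continuous_deriv le_rfl).enorm.measurable.aemeasurable
        simpa using h

theorem enorm_add_sq_le (a b : ℝ) : ‖a + b‖ₑ ^ 2 ≤ 2 * ‖a‖ₑ ^ 2 + 2 * ‖b‖ₑ ^ 2 := by
  simp only [Real.enorm_eq_ofReal_abs, ← ENNReal.ofReal_pow (abs_nonneg _), sq_abs]
  rw [← ENNReal.ofReal_ofNat, ← ENNReal.ofReal_mul (by norm_num), ← ENNReal.ofReal_mul (by norm_num),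
    ← ENNReal.ofReal_add (by positivity) (by positivity)]
  exact ENNReal.ofReal_le_ofReal (by nlinarith [sq_nonneg (a - b)])

section Plane

variable {g : ℂ → ℝ}

theorem measurable_enorm_fderiv_sq (hg : ContDiff ℝ 1 g) :
    Measurable fun x => ‖fderiv ℝ g x‖ₑ ^ 2 :=
  (hg.continuous_fderiv one_ne_zero).enorm.measurable.pow_const 2

/-- The `L²` estimate for differences. -/
theorem lintegral_enorm_sub_translate_sq_le (hg : ContDiff ℝ 1 g) (h : ℂ) :
    ∫⁻ x, ‖g (x + h) - g x‖ₑ ^ 2 ≤ ‖h‖ₑ ^ 2 * ∫⁻ x, ‖fderiv ℝ g x‖ₑ ^ 2 := by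
  have hm := measurable_enorm_fderiv_sq hg
  have key (x : ℂ) : ‖g (x + h) - g x‖ₑ ^ 2 ≤
      ∫⁻ t in Icc (0 : ℝ) 1, ‖h‖ₑ ^ 2 * ‖fderiv ℝ g (x + t • h)‖ₑ ^ 2 := by
    have hφ : ContDiff ℝ 1 fun t : ℝ => g (x + t • h) := by fun_prop
    have := enorm_sub_sq_le_lintegral_deriv hφ (left_mem_Icc.2 zero_le_one)
      (right_mem_Icc.2 (zero_le_one (α := ℝ)))
    simp only [one_smul, zero_smul, add_zero, sub_zero, ENNReal.ofReal_one, one_mul] at this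
    refine this.trans (lintegral_mono fun t => ?_)
    have hd : HasDerivAt (fun t : ℝ => g (x + t • h)) (fderiv ℝ g (x + t • h) h) t := by
      have h1 : HasDerivAt (fun t : ℝ => x + t • h) h t := by
        simpa using ((hasDerivAt_id t).smul_const h).const_add x
      exact ((hg.differentiable one_ne_zero) _).hasFDerivAt.comp_hasDerivAt t h1
    rw [hd.deriv, ← mul_pow, mul_comm]
    gcongr
    exact ContinuousLinearMap.le_opENorm _ _
  calc ∫⁻ x, ‖g (x + h) - g x‖ₑ ^ 2
      ≤ ∫⁻ x, ∫⁻ t in Icc (0 : ℝ) 1, ‖h‖ₑ ^ 2 * ‖fderiv ℝ g (x + t • h)‖ₑ ^ 2 :=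
        lintegral_mono key
    _ = ∫⁻ t in Icc (0 : ℝ) 1, ∫⁻ x, ‖h‖ₑ ^ 2 * ‖fderiv ℝ g (x + t • h)‖ₑ ^ 2 := by
        refine lintegral_lintegral_swap (Measurable.aemeasurable ?_)
        exact (hm.comp (f := fun p : ℂ × ℝ => p.1 + p.2 • h) (by fun_prop)).const_mul _
    _ = ∫⁻ t in Icc (0 : ℝ) 1, ‖h‖ₑ ^ 2 * ∫⁻ x, ‖fderiv ℝ g x‖ₑ ^ 2 := by
        refine lintegral_congr fun t => ?_
        have hmt : Measurable fun x => ‖fderiv ℝ g (x + t • h)‖ₑ ^ 2 :=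
          hm.comp (measurable_add_const _)
        rw [lintegral_const_mul _ hmt,
          lintegral_add_right_eq_self (fun x => ‖fderiv ℝ g x‖ₑ ^ 2)]
    _ = _ := by simp

/-- On a circle where `g` has a zero, `g` is controlled by its derivative on that circle. -/
theorem lintegral_circle_enorm_sq_le (hg : ContDiff ℝ 1 g) (z : ℂ) {r : ℝ} (hr : r ∈ Ioo (0 : ℝ) 1)
    (hz : ∃ w ∈ sphere z r, g w = 0) :
    ∫⁻ θ in Ioo (-Real.pi) Real.pi, ‖g (z + Complex.polarCoord.symm (r, θ))‖ₑ ^ 2 ≤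
      ENNReal.ofReal (2 * Real.pi) ^ 2 * ∫⁻ θ in Ioo (-Real.pi) Real.pi,
        ‖fderiv ℝ g (z + Complex.polarCoord.symm (r, θ))‖ₑ ^ 2 := by
  have hpol (θ : ℝ) : z + Complex.polarCoord.symm (r, θ) = circleMap z r θ := by
    simp [circleMap, Complex.polarCoord_symm_apply, Complex.exp_mul_I]
  simp only [hpol]
  obtain ⟨w, hw, hgw⟩ := hz
  obtain ⟨s, hs, hsw⟩ : ∃ s ∈ Icc (-Real.pi) Real.pi, circleMap z r s = w := by
    refine ⟨Complex.arg (w - z), ⟨(Complex.neg_pi_lt_arg _).le, Complex.arg_le_pi _⟩, ?_⟩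
    have hn : ‖w - z‖ = r := by simpa [dist_eq_norm] using hw
    rw [circleMap, ← hn, Complex.norm_mul_exp_arg_mul_I]
    ring
  have hφ : ContDiff ℝ 1 fun θ : ℝ => g (circleMap z r θ) := hg.comp (contDiff_circleMap z r)
  have hd (θ : ℝ) : ‖deriv (fun θ : ℝ => g (circleMap z r θ)) θ‖ₑ ≤
      ‖fderiv ℝ g (circleMap z r θ)‖ₑ := by
    have h1 := ((hg.differentiable one_ne_zero) _).hasFDerivAt.comp_hasDerivAt θ
      (hasDerivAt_circleMap z r θ)
    have h2 : ‖circleMap 0 r θ * Complex.I‖ₑ ≤ 1 := by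
      rw [← ofReal_norm]
      simpa [abs_of_pos hr.1] using hr.2.le
    rw [show deriv (fun θ : ℝ => g (circleMap z r θ)) θ = _ from h1.deriv]
    refine (ContinuousLinearMap.le_opENorm _ _).trans ?_
    exact mul_le_of_le_one_right' h2
  have key (θ : ℝ) (hθ : θ ∈ Ioo (-Real.pi) Real.pi) : ‖g (circleMap z r θ)‖ₑ ^ 2 ≤
      ENNReal.ofReal (2 * Real.pi) * ∫⁻ θ in Ioo (-Real.pi) Real.pi,
        ‖fderiv ℝ g (circleMap z r θ)‖ₑ ^ 2 := by
    have := enorm_sub_sq_le_lintegral_deriv hφ hs (Ioo_subset_Icc_self hθ)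
    rw [hsw, hgw, sub_zero, sub_neg_eq_add, ← two_mul, ← setLIntegral_congr Ioo_ae_eq_Icc] at this
    refine this.trans ?_
    gcongr with θ
    exact hd θ
  refine (setLIntegral_mono' measurableSet_Ioo key).trans_eq ?_
  rw [setLIntegral_const, Real.volume_Ioo, sub_neg_eq_add, ← two_mul]
  ring

/-- If `g` has a zero on all small circles about `z`, it is controlled near `z` by its energy. -/
theorem lintegral_ball_enorm_sq_le (hg : ContDiff ℝ 1 g) (z : ℂ)
    (hz : ∀ r ∈ Ioo (0 : ℝ) 1, ∃ w ∈ sphere z r, g w = 0) :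
    ∫⁻ x in ball z 1, ‖g x‖ₑ ^ 2 ≤
      ENNReal.ofReal (2 * Real.pi) ^ 2 * ∫⁻ x in ball z 1, ‖fderiv ℝ g x‖ₑ ^ 2 := by
  have polar (u : ℂ → ℝ≥0∞) (hu : Measurable u) : ∫⁻ x in ball z 1, u x =
      ∫⁻ r in Ioo (0 : ℝ) 1, ENNReal.ofReal r * ∫⁻ θ in Ioo (-Real.pi) Real.pi,
        u (z + Complex.polarCoord.symm (r, θ)) := by
    have hc : Continuous fun p : ℝ × ℝ => Complex.polarCoord.symm p := by
      simp only [Complex.polarCoord_symm_apply]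
      fun_prop
    have hm : Measurable ((ball z 1).indicator u) := hu.indicator measurableSet_ball
    rw [← lintegral_indicator measurableSet_ball,
      ← lintegral_add_left_eq_self _ z, ← Complex.lintegral_comp_polarCoord_symm, polarCoord_target,
      Measure.volume_eq_prod, ← Measure.prod_restrict, lintegral_prod]
    · rw [show Ioo (0 : ℝ) 1 = Iio 1 ∩ Ioi 0 from (inter_comm _ _), 
        ← Measure.restrict_restrict measurableSet_Iio,
        ← lintegral_indicator measurableSet_Iio]
      refine setLIntegral_congr_fun measurableSet_Ioi fun r hr => ?_
      have hr0 : 0 < r := hr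
      have hiff (θ : ℝ) : z + Complex.polarCoord.symm (r, θ) ∈ ball z 1 ↔ r < 1 := by
        simp [abs_of_pos hr0]
      by_cases h1 : r < 1
      · simp only [smul_eq_mul, indicator_of_mem, hiff, h1, mem_Iio]
        rw [lintegral_const_mul]
        exact hu.comp (by fun_prop)
      · have hnot (θ : ℝ) : z + Complex.polarCoord.symm (r, θ) ∉ ball z 1 :=
          fun h => h1 ((hiff θ).1 h)
        simp only [indicator_of_notMem (hnot _), indicator_of_notMem (show r ∉ Iio (1 : ℝ) from h1),
          smul_zero, lintegral_zero]
    · refine Measurable.aemeasurable ?_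
      exact (by fun_prop : Measurable fun p : ℝ × ℝ => ENNReal.ofReal p.1).smul
        (hm.comp (by fun_prop))
  rw [polar _ (hg.continuous.enorm.measurable.pow_const 2), polar _ (measurable_enorm_fderiv_sq hg),
    ← lintegral_const_mul']
  · refine setLIntegral_mono' measurableSet_Ioo fun r hr => ?_
    rw [mul_left_comm]
    gcongr
    exact lintegral_circle_enorm_sq_le hg z hr (hz r hr)
  · finiteness

/-- The Poincaré inequality for a `C¹` function on the plane such that each point lies within `C`
of a point all of whose small surrounding circles meet the zero set. -/
theorem lintegral_enorm_sq_le_of_porous (hg : ContDiff ℝ 1 g) {C : ℝ}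
    (hz : ∀ x, ∃ z, dist x z ≤ C ∧ ∀ r ∈ Ioo (0 : ℝ) 1, ∃ w ∈ sphere z r, g w = 0) :
    volume (ball (0 : ℂ) 1) * ∫⁻ x, ‖g x‖ₑ ^ 2 ≤
      2 * (ENNReal.ofReal (2 * Real.pi) ^ 2 + ENNReal.ofReal (C + 1) ^ 2) *
        volume (ball (0 : ℂ) (C + 1)) * ∫⁻ x, ‖fderiv ℝ g x‖ₑ ^ 2 := by
  have hm := measurable_enorm_fderiv_sq hg
  have hmg : Measurable fun x => ‖g x‖ₑ ^ 2 := (hg.continuous.enorm.measurable.pow_const 2)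
  have hc := hg.continuous
  set P : ℝ≥0∞ := ENNReal.ofReal (2 * Real.pi) ^ 2
  set E := ∫⁻ x, ‖fderiv ℝ g x‖ₑ ^ 2
  set B := ball (0 : ℂ) (C + 1)
  have hm1 : Measurable fun p : ℂ × ℂ => ‖fderiv ℝ g (p.1 + p.2)‖ₑ ^ 2 :=
    hm.comp (measurable_fst.add measurable_snd)
  have hm2 : Measurable fun p : ℂ × ℂ => ‖g (p.1 + p.2) - g p.1‖ₑ ^ 2 :=
    (by fun_prop : Continuous fun p : ℂ × ℂ => g (p.1 + p.2) - g p.1).enorm.measurable.pow_const 2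
  have shift (u : ℂ → ℝ≥0∞) (x : ℂ) : ∫⁻ y in ball x (C + 1), u y = ∫⁻ h in B, u (x + h) := by
    rw [← lintegral_indicator measurableSet_ball, ← lintegral_add_left_eq_self _ x,
      ← lintegral_indicator measurableSet_ball]
    refine lintegral_congr fun h => ?_
    simp [indicator]
  have key (x : ℂ) : volume (ball (0 : ℂ) 1) * ‖g x‖ₑ ^ 2 ≤
      ∫⁻ h in B, (2 * (P * ‖fderiv ℝ g (x + h)‖ₑ ^ 2) + 2 * ‖g (x + h) - g x‖ₑ ^ 2) := by
    obtain ⟨z, hxz, hz⟩ := hz x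
    have hsub : ball z 1 ⊆ ball x (C + 1) :=
      ball_subset_ball' (by rw [dist_comm]; linarith)
    calc volume (ball (0 : ℂ) 1) * ‖g x‖ₑ ^ 2 = ∫⁻ _ in ball z 1, ‖g x‖ₑ ^ 2 := by
          rw [setLIntegral_const, mul_comm, Measure.addHaar_ball_center volume z]
      _ ≤ ∫⁻ u in ball z 1, (2 * ‖g u‖ₑ ^ 2 + 2 * ‖g u - g x‖ₑ ^ 2) := by
          refine lintegral_mono fun u => ?_
          have := enorm_add_sq_le (g u) (-(g u - g x))
          rwa [enorm_neg, neg_sub, add_sub_cancel] at this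
      _ = 2 * (∫⁻ u in ball z 1, ‖g u‖ₑ ^ 2) + ∫⁻ u in ball z 1, 2 * ‖g u - g x‖ₑ ^ 2 := by
          rw [lintegral_add_left (hmg.const_mul 2), lintegral_const_mul _ hmg]
      _ ≤ 2 * (P * ∫⁻ u in ball x (C + 1), ‖fderiv ℝ g u‖ₑ ^ 2) +
            ∫⁻ u in ball x (C + 1), 2 * ‖g u - g x‖ₑ ^ 2 := by
          gcongr
          exact (lintegral_ball_enorm_sq_le hg z hz).trans
            (by gcongr)
      _ = ∫⁻ u in ball x (C + 1), (2 * (P * ‖fderiv ℝ g u‖ₑ ^ 2) + 2 * ‖g u - g x‖ₑ ^ 2) := by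
          rw [lintegral_add_left ((hm.const_mul P).const_mul 2),
            lintegral_const_mul _ (hm.const_mul P), lintegral_const_mul _ hm]
      _ = _ := shift _ x
  calc volume (ball (0 : ℂ) 1) * ∫⁻ x, ‖g x‖ₑ ^ 2
      = ∫⁻ x, volume (ball (0 : ℂ) 1) * ‖g x‖ₑ ^ 2 := (lintegral_const_mul _ hmg).symm
    _ ≤ ∫⁻ x, ∫⁻ h in B, (2 * (P * ‖fderiv ℝ g (x + h)‖ₑ ^ 2) + 2 * ‖g (x + h) - g x‖ₑ ^ 2) :=
        lintegral_mono key
    _ = ∫⁻ h in B, ∫⁻ x, (2 * (P * ‖fderiv ℝ g (x + h)‖ₑ ^ 2) + 2 * ‖g (x + h) - g x‖ₑ ^ 2) :=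
        lintegral_lintegral_swap
          (((hm1.const_mul P).const_mul 2).add (hm2.const_mul 2)).aemeasurable
    _ ≤ ∫⁻ h in B, 2 * (P + ENNReal.ofReal (C + 1) ^ 2) * E := by
        refine setLIntegral_mono' measurableSet_ball fun h hh => ?_
        have hmh : Measurable fun x => ‖fderiv ℝ g (x + h)‖ₑ ^ 2 :=
          hm.comp (measurable_add_const h)
        rw [lintegral_add_left ((hmh.const_mul P).const_mul 2),
          lintegral_const_mul _ (hmh.const_mul P), lintegral_const_mul _ hmh,
          lintegral_const_mul' _ _ (by finiteness),
          lintegral_add_right_eq_self (fun x => ‖fderiv ℝ g x‖ₑ ^ 2), mul_assoc, add_mul, mul_add]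
        gcongr
        refine (lintegral_enorm_sub_translate_sq_le hg h).trans ?_
        gcongr
        rw [← ofReal_norm]
        exact ENNReal.ofReal_le_ofReal (by simpa using (mem_ball_zero_iff.1 hh).le)
    _ = _ := by
        rw [setLIntegral_const]
        ring

end Plane

/-- **Lemma 1 (Poincaré constant for porous domains).** -/
theorem poincare_porous :
    ∀ C : ℝ, 1 < C → ∃ Ct : ℝ, 0 < Ct ∧
      ∀ (R : ℝ) (F : Set E2), 1 < R → IsClosed F → F ⊆ ball (0 : E2) R →
        (∀ z₀ ∈ F, ∀ r : ℝ, 0 < r → r ≤ 1 →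
          (sphere z₀ r ∩ (F ∪ sphere (0 : E2) R)).Nonempty) →
        (∀ x ∈ ball (0 : E2) R, Metric.infDist x (F ∪ sphere (0 : E2) R) ≤ C) →
        ∀ f : E2 → ℝ, IsTestFun (ball (0 : E2) R \ F) f →
          ∫ x in ball (0 : E2) R \ F, f x ^ 2 ≤
            Ct * ∫ x in ball (0 : E2) R \ F, ‖gradient f x‖ ^ 2 := by
  intro C hC
  set V := volume (ball (0 : ℂ) 1)
  set K : ℝ≥0∞ := 2 * (ENNReal.ofReal (2 * Real.pi) ^ 2 + ENNReal.ofReal (C + 1) ^ 2) *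
        volume (ball (0 : ℂ) (C + 1))
  have hV0 : V ≠ 0 := (measure_ball_pos volume 0 one_pos).ne'
  have hV : V ≠ ∞ := measure_ball_lt_top.ne
  have hW : volume (ball (0 : ℂ) (C + 1)) ≠ ∞ := measure_ball_lt_top.ne
  have hK : K ≠ ∞ := by finiteness
  have hK0 : K ≠ 0 := by
    have h1 : volume (ball (0 : ℂ) (C + 1)) ≠ 0 := (measure_ball_pos volume 0 (by linarith)).ne'
    have h2 : ENNReal.ofReal (C + 1) ≠ 0 := by simp; linarith
    exact mul_ne_zero (mul_ne_zero two_ne_zero (by simp [h2])) h1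
  refine ⟨K.toReal / V.toReal, div_pos (ENNReal.toReal_pos hK0 hK) (ENNReal.toReal_pos hV0 hV), ?_⟩
  intro R F hR hF hFR hcirc hdist f ⟨hf, hfc, hfs⟩
  have hf1 : ContDiff ℝ 1 f := hf.of_le (by exact_mod_cast le_top)
  have hzero (x : E2) (hx : x ∉ ball (0 : E2) R \ F) : f x = 0 :=
    image_eq_zero_of_notMem_tsupport fun h => hx (hfs h)
  have hout (x : E2) (hx : x ∈ F ∪ {y | R ≤ ‖y‖}) : f x = 0 := by
    refine hzero x fun h => ?_
    rcases hx with hx | hx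
    · exact h.2 hx
    · exact absurd (mem_ball_zero_iff.1 h.1) (not_lt.2 hx)
  have hradial (z : E2) (hz : R ≤ ‖z‖) (r : ℝ) (hr : 0 < r) : ∃ w ∈ sphere z r, f w = 0 := by
    have hz0 : 0 < ‖z‖ := by linarith
    refine ⟨z + (r / ‖z‖) • z, ?_, hout _ (Or.inr ?_)⟩
    · simp [norm_smul, abs_of_pos hr, hz0.ne']
    · rw [mem_ofPred_eq, show z + (r / ‖z‖) • z = (1 + r / ‖z‖) • z by module,
        norm_smul, Real.norm_of_nonneg (by positivity)]
      have : 0 < r / ‖z‖ := by positivity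
      nlinarith
  have hporous (x : E2) : ∃ z, dist x z ≤ C ∧
      ∀ r ∈ Ioo (0 : ℝ) 1, ∃ w ∈ sphere z r, f w = 0 := by
    by_cases hx : x ∈ ball (0 : E2) R
    · have hne : (F ∪ sphere (0 : E2) R).Nonempty :=
        (NormedSpace.sphere_nonempty.2 (by linarith)).inr
      obtain ⟨z, hz, hxz⟩ := (hF.union isClosed_sphere).exists_infDist_eq_dist hne x
      refine ⟨z, hxz ▸ hdist x hx, fun r hr => ?_⟩
      rcases hz with hz | hz
      · obtain ⟨w, hw, hw'⟩ := hcirc z hz r hr.1 hr.2.le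
        exact ⟨w, hw, hout w (hw'.imp_right fun h => (mem_sphere_zero_iff_norm.1 h).ge)⟩
      · exact hradial z (mem_sphere_zero_iff_norm.1 hz).ge r hr.1
    · refine ⟨x, by simp; linarith, fun r hr => hradial x ?_ r hr.1⟩
      simpa using hx
  let L : ℂ ≃ₗᵢ[ℝ] E2 := Complex.orthonormalBasisOneI.repr
  have hL : MeasurePreserving L volume volume := L.measurePreserving
  have hLe : MeasurableEmbedding L := L.toHomeomorph.measurableEmbedding
  have hmain := lintegral_enorm_sq_le_of_porous (g := f ∘ L) (C := C)
    (hf1.comp L.contDiff) fun x => by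
      obtain ⟨z, hxz, hz⟩ := hporous (L x)
      refine ⟨L.symm z, ?_, fun r hr => ?_⟩
      · rwa [← L.dist_map, L.apply_symm_apply]
      · obtain ⟨w, hw, hfw⟩ := hz r hr
        refine ⟨L.symm w, ?_, by simpa using hfw⟩
        rwa [mem_sphere, L.symm.dist_map]
  have hgrad (x : E2) : ‖gradient f x‖ = ‖fderiv ℝ f x‖ := by simp [gradient]
  have hfd (x : ℂ) : ‖fderiv ℝ (f ∘ L) x‖ₑ = ‖fderiv ℝ f (L x)‖ₑ := by
    have : fderiv ℝ (f ∘ L) x = (fderiv ℝ f (L x)).comp (L : ℂ →L[ℝ] E2) :=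
      L.toContinuousLinearEquiv.comp_right_fderiv
    rw [this, ← ofReal_norm, ← ofReal_norm]
    congr 1
    exact ContinuousLinearMap.opNorm_comp_linearIsometryEquiv _ L
  simp only [hfd, Function.comp_apply] at hmain
  rw [hL.lintegral_comp_emb hLe (fun x => ‖f x‖ₑ ^ 2),
    hL.lintegral_comp_emb hLe (fun x => ‖fderiv ℝ f x‖ₑ ^ 2)] at hmain
  have hfdc : Continuous (fderiv ℝ f) := hf1.continuous_fderiv one_ne_zero
  have hi1 : Integrable fun x => f x ^ 2 :=
    (hf1.continuous.pow 2).integrable_of_hasCompactSupport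
      (hfc.mono fun x hx h => hx (by simp [h]))
  have hi2 : Integrable fun x => ‖fderiv ℝ f x‖ ^ 2 :=
    (hfdc.norm.pow 2).integrable_of_hasCompactSupport
      ((hfc.fderiv ℝ).mono fun x hx h => hx (by simp [h]))
  have e1 : ∫⁻ x, ‖f x‖ₑ ^ 2 = ENNReal.ofReal (∫ x, f x ^ 2) := by
    rw [ofReal_integral_eq_lintegral_ofReal hi1 (ae_of_all _ fun x => sq_nonneg _)]
    refine lintegral_congr fun x => ?_
    rw [← ofReal_norm, ← ENNReal.ofReal_pow (norm_nonneg _), Real.norm_eq_abs, sq_abs]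
  have e2 : ∫⁻ x, ‖fderiv ℝ f x‖ₑ ^ 2 = ENNReal.ofReal (∫ x, ‖fderiv ℝ f x‖ ^ 2) := by
    rw [ofReal_integral_eq_lintegral_ofReal hi2 (ae_of_all _ fun x => sq_nonneg _)]
    refine lintegral_congr fun x => ?_
    rw [← ofReal_norm, ← ENNReal.ofReal_pow (norm_nonneg _)]
  have n1 : 0 ≤ ∫ x, f x ^ 2 := integral_nonneg fun x => sq_nonneg _
  have n2 : 0 ≤ ∫ x, ‖fderiv ℝ f x‖ ^ 2 := integral_nonneg fun x => sq_nonneg _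
  have hreal : V.toReal * ∫ x, f x ^ 2 ≤ K.toReal * ∫ x, ‖fderiv ℝ f x‖ ^ 2 := by
    rw [e1, e2] at hmain
    have := ENNReal.toReal_mono (by finiteness) hmain
    rwa [ENNReal.toReal_mul, ENNReal.toReal_mul, ENNReal.toReal_ofReal n1,
      ENNReal.toReal_ofReal n2] at this
  simp only [hgrad]
  rw [setIntegral_eq_integral_of_forall_compl_eq_zero fun x hx => by simp [hzero x hx],
    setIntegral_eq_integral_of_forall_compl_eq_zero fun x hx => by
      have : fderiv ℝ f x = 0 :=
        image_eq_zero_of_notMem_tsupport fun h => hx (hfs (tsupport_fderiv_subset ℝ h))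
      simp [this],
    div_mul_eq_mul_div, le_div_iff₀ (ENNReal.toReal_pos hV0 hV), mul_comm]
  exact hreal
end
end
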